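/- arXiv:1311.4524 — 2 statements merged into one kernel-verified Lean document; each statement's English description precedes it below -/
import Mathlib

section
/- The linear Chacon map T is mildly mixing: for every measurable set A ⊆ X with 0 < μ(A) < 1, limsup_{n→∞} μ(A ∩ T^nA) < μ(A). -/
open MeasureTheory Filter Topology
open scoped symmDiff

/-- A Chacon-type rank-one map (cutting into 3, spacer sequence `s` over the middle
column), acting on a probability space `(X, μ)`. -/
structure ChaconMap {X : Type*} [MeasurableSpace X]
    (μ : Measure X) (s : ℕ → ℕ) : Type _ where
  /-- The transformation, an invertible bimeasurable map. -/
  T : X ≃ᵐ X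
  measurePreserving : MeasurePreserving T μ μ
  /-- The tower heights (number of levels is `h j + 1`). -/
  h : ℕ → ℕ
  h_one : h 1 = 1
  h_succ : ∀ j, 1 ≤ j → h (j + 1) = 3 * h j + 2 + s j
  /-- The base of the `j`-th tower. -/
  E : ℕ → Set X
  E1 : ℕ → Set X
  E2 : ℕ → Set X
  E3 : ℕ → Set X
  measE : ∀ j, MeasurableSet (E j)
  measE1 : ∀ j, MeasurableSet (E1 j)
  measE2 : ∀ j, MeasurableSet (E2 j)
  measE3 : ∀ j, MeasurableSet (E3 j)
  /-- (i) the levels of the `j`-th tower are pairwise disjoint. -/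
  tower_disjoint : ∀ j, 1 ≤ j → ∀ i ≤ h j, ∀ i' ≤ h j, i ≠ i' →
    Disjoint ((⇑T)^[i] '' E j) ((⇑T)^[i'] '' E j)
  /-- (ii) the base is cut into three pieces of equal measure. -/
  E_union : ∀ j, 1 ≤ j → E j = E1 j ∪ E2 j ∪ E3 j
  E_disj12 : ∀ j, 1 ≤ j → Disjoint (E1 j) (E2 j)
  E_disj13 : ∀ j, 1 ≤ j → Disjoint (E1 j) (E3 j)
  E_disj23 : ∀ j, 1 ≤ j → Disjoint (E2 j) (E3 j)
  E_meas12 : ∀ j, 1 ≤ j → μ (E1 j) = μ (E2 j)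
  E_meas23 : ∀ j, 1 ≤ j → μ (E2 j) = μ (E3 j)
  E_next : ∀ j, 1 ≤ j → E (j + 1) = E1 j
  /-- (iii) stacking: the top of the first column is sent to the base of the second. -/
  stack1 : ∀ j, 1 ≤ j → μ (((⇑T)^[h j + 1] '' E1 j) ∆ E2 j) = 0
  /-- (iii) stacking: the top spacer over the second column is sent to the third base. -/
  stack2 : ∀ j, 1 ≤ j → μ (((⇑T)^[h j + 1 + s j] '' E2 j) ∆ E3 j) = 0
  /-- (iii) the spacer levels are disjoint from the `j`-th tower. -/
  spacer_disjoint : ∀ j, 1 ≤ j → ∀ i, 1 ≤ i → i ≤ s j → ∀ i' ≤ h j,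
    Disjoint ((⇑T)^[h j + i] '' E2 j) ((⇑T)^[i'] '' E j)
  /-- (iv) the towers fill up the whole space. -/
  tower_full : Tendsto (fun j => μ (⋃ i ∈ Finset.range (h j + 1), (⇑T)^[i] '' E j))
    atTop (𝓝 1)
  /-- (iv) the levels of the towers generate the full σ-algebra mod `μ`. -/
  generates : ∀ A : Set X, MeasurableSet A → ∃ B : Set X,
    MeasurableSet[MeasurableSpace.generateFrom
      {S : Set X | ∃ j, 1 ≤ j ∧ ∃ i ≤ h j, S = (⇑T)^[i] '' E j}] B ∧ μ (A ∆ B) = 0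

namespace ChaconMap

variable {X : Type*} [MeasurableSpace X] {μ : Measure X} {s : ℕ → ℕ}

/-- Image under the `n`-th iterate. -/
def U (C : ChaconMap μ s) (n : ℕ) (S : Set X) : Set X := (⇑C.T)^[n] '' S

/-- Number of levels. -/
def H (C : ChaconMap μ s) (j : ℕ) : ℕ := C.h j + 1

/-- Union of levels. -/
def Lv (C : ChaconMap μ s) (j : ℕ) (I : Finset ℕ) : Set X := ⋃ i ∈ I, C.U i (C.E j)

theorem H_succ (C : ChaconMap μ s) {j : ℕ} (hj : 1 ≤ j) : C.H (j + 1) = 3 * C.H j + s j := by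
  have := C.h_succ j hj
  unfold H; omega

theorem U_zero (C : ChaconMap μ s) (S : Set X) : C.U 0 S = S := by simp [U]

theorem U_one (C : ChaconMap μ s) (S : Set X) : C.U 1 S = C.T '' S := by simp [U]

theorem U_add (C : ChaconMap μ s) (m n : ℕ) (S : Set X) : C.U m (C.U n S) = C.U (m + n) S := by
  unfold U
  rw [Set.image_image, Function.iterate_add]
  rfl

theorem inj (C : ChaconMap μ s) (n : ℕ) : Function.Injective (⇑C.T)^[n] := C.T.injective.iterate n

theorem U_mono (C : ChaconMap μ s) (n : ℕ) {S S' : Set X} (h : S ⊆ S') : C.U n S ⊆ C.U n S' :=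
  Set.image_mono h

theorem U_union (C : ChaconMap μ s) (n : ℕ) (S S' : Set X) :
    C.U n (S ∪ S') = C.U n S ∪ C.U n S' := Set.image_union _ _ _

theorem U_diff (C : ChaconMap μ s) (n : ℕ) (S S' : Set X) :
    C.U n (S \ S') = C.U n S \ C.U n S' := Set.image_sdiff (C.inj n) _ _

theorem U_symmDiff (C : ChaconMap μ s) (n : ℕ) (S S' : Set X) :
    C.U n (S ∆ S') = C.U n S ∆ C.U n S' := Set.image_symmDiff (C.inj n) _ _

theorem U_disj (C : ChaconMap μ s) (n : ℕ) {S S' : Set X} (h : Disjoint S S') :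
    Disjoint (C.U n S) (C.U n S') := (Set.disjoint_image_iff (C.inj n)).2 h

theorem U_meas (C : ChaconMap μ s) (n : ℕ) {S : Set X} (h : MeasurableSet S) :
    MeasurableSet (C.U n S) := by
  induction n with
  | zero => rwa [U_zero]
  | succ n ih =>
    rw [add_comm, ← U_add, U_one]
    exact C.T.measurableSet_image.2 ih

theorem μ_U (C : ChaconMap μ s) (n : ℕ) (S : Set X) : μ (C.U n S) = μ S := by
  induction n with
  | zero => rw [U_zero]
  | succ n ih =>
    rw [add_comm, ← U_add, U_one, MeasurableEquiv.image_eq_preimage_symm,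
      (C.measurePreserving.symm C.T).measure_preimage_equiv, ih]

theorem real_U (C : ChaconMap μ s) (n : ℕ) (S : Set X) : μ.real (C.U n S) = μ.real S := by
  simp [Measure.real, μ_U]

theorem U_ae_le (C : ChaconMap μ s) (n : ℕ) {S S' : Set X} (h : S ≤ᵐ[μ] S') :
    C.U n S ≤ᵐ[μ] C.U n S' := by
  rw [ae_le_set] at h ⊢
  rw [← U_diff, μ_U, h]

theorem U_ae_eq (C : ChaconMap μ s) (n : ℕ) {S S' : Set X} (h : S =ᵐ[μ] S') :
    C.U n S =ᵐ[μ] C.U n S' :=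
  (C.U_ae_le n h.le).antisymm (C.U_ae_le n h.symm.le)

theorem E2_ae (C : ChaconMap μ s) {j : ℕ} (hj : 1 ≤ j) :
    C.U (C.H j) (C.E (j + 1)) =ᵐ[μ] C.E2 j := by
  rw [C.E_next j hj]
  exact measure_symmDiff_eq_zero_iff.1 (C.stack1 j hj)

theorem E3_ae' (C : ChaconMap μ s) {j : ℕ} (hj : 1 ≤ j) :
    C.U (C.H j + s j) (C.E2 j) =ᵐ[μ] C.E3 j :=
  measure_symmDiff_eq_zero_iff.1 (C.stack2 j hj)

theorem E3_ae (C : ChaconMap μ s) {j : ℕ} (hj : 1 ≤ j) :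
    C.U (2 * C.H j + s j) (C.E (j + 1)) =ᵐ[μ] C.E3 j := by
  have h1 := C.U_ae_eq (C.H j + s j) (C.E2_ae hj)
  rw [U_add] at h1
  have h2 := h1.trans (C.E3_ae' hj)
  rwa [show 2 * C.H j + s j = C.H j + s j + C.H j by omega]

theorem E1_sub (C : ChaconMap μ s) {j : ℕ} (hj : 1 ≤ j) : C.E (j + 1) ⊆ C.E j := by
  rw [C.E_next j hj, C.E_union j hj]
  intro x; simp; tauto

theorem E2_sub (C : ChaconMap μ s) {j : ℕ} (hj : 1 ≤ j) : C.E2 j ⊆ C.E j := by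
  rw [C.E_union j hj]
  intro x; simp; tauto

theorem E3_sub (C : ChaconMap μ s) {j : ℕ} (hj : 1 ≤ j) : C.E3 j ⊆ C.E j := by
  rw [C.E_union j hj]
  intro x; simp; tauto

theorem E_ae (C : ChaconMap μ s) {j : ℕ} (hj : 1 ≤ j) :
    (C.E (j + 1) ∪ C.U (C.H j) (C.E (j + 1)) ∪ C.U (2 * C.H j + s j) (C.E (j + 1)) : Set X)
      =ᵐ[μ] C.E j := by
  rw [C.E_union j hj]
  refine ae_eq_set_union (ae_eq_set_union ?_ (C.E2_ae hj)) (C.E3_ae hj)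
  rw [C.E_next j hj]
  exact ae_eq_refl _

theorem real_E2 (C : ChaconMap μ s) {j : ℕ} (hj : 1 ≤ j) :
    μ.real (C.E2 j) = μ.real (C.E (j + 1)) := by
  rw [C.E_next j hj, Measure.real, Measure.real, C.E_meas12 j hj]

theorem real_E (C : ChaconMap μ s) [IsProbabilityMeasure μ] {j : ℕ} (hj : 1 ≤ j) :
    μ.real (C.E j) = 3 * μ.real (C.E (j + 1)) := by
  have h2 := C.real_E2 hj
  have h3 : μ.real (C.E3 j) = μ.real (C.E2 j) := by simp [Measure.real, C.E_meas23 j hj]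
  rw [C.E_union j hj, measureReal_union _ (C.measE3 j), measureReal_union (C.E_disj12 j hj)
    (C.measE2 j), ← C.E_next j hj]
  · linarith
  · exact Disjoint.union_left (C.E_disj13 j hj) (C.E_disj23 j hj)

theorem lev_disj (C : ChaconMap μ s) {j : ℕ} (hj : 1 ≤ j) {i i' : ℕ} (hi : i < C.H j)
    (hi' : i' < C.H j) (h : i ≠ i') : Disjoint (C.U i (C.E j)) (C.U i' (C.E j)) :=
  C.tower_disjoint j hj i (by unfold H at hi; omega) i' (by unfold H at hi'; omega) h

theorem Lv_meas (C : ChaconMap μ s) (j : ℕ) (I : Finset ℕ) : MeasurableSet (C.Lv j I) :=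
  Finset.measurableSet_biUnion _ fun i _ => C.U_meas i (C.measE j)

theorem Lv_union (C : ChaconMap μ s) (j : ℕ) (I J : Finset ℕ) :
    C.Lv j (I ∪ J) = C.Lv j I ∪ C.Lv j J := Finset.set_biUnion_union _ _ _

theorem Lv_real_inter (C : ChaconMap μ s) [IsProbabilityMeasure μ] {j : ℕ} (hj : 1 ≤ j)
    {I : Finset ℕ} (hI : I ⊆ Finset.range (C.H j)) {A : Set X} (hA : MeasurableSet A) :
    μ.real (A ∩ C.Lv j I) = ∑ i ∈ I, μ.real (A ∩ C.U i (C.E j)) := by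
  unfold Lv
  rw [Set.inter_iUnion₂, measureReal_biUnion_finset]
  · intro i hi i' hi' hne
    exact (C.lev_disj hj (Finset.mem_range.1 (hI hi)) (Finset.mem_range.1 (hI hi')) hne).mono
      Set.inter_subset_right Set.inter_subset_right
  · intro i _
    exact hA.inter (C.U_meas i (C.measE j))

theorem Lv_real (C : ChaconMap μ s) [IsProbabilityMeasure μ] {j : ℕ} (hj : 1 ≤ j)
    {I : Finset ℕ} (hI : I ⊆ Finset.range (C.H j)) :
    μ.real (C.Lv j I) = I.card * μ.real (C.E j) := by
  have := C.Lv_real_inter hj hI MeasurableSet.univ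
  simpa [real_U] using this

theorem mem_Lv (C : ChaconMap μ s) {j : ℕ} {I : Finset ℕ} {x : X} :
    x ∈ C.Lv j I ↔ ∃ i ∈ I, x ∈ C.U i (C.E j) := by simp [Lv]

theorem mem_Lv_iff (C : ChaconMap μ s) {j : ℕ} (hj : 1 ≤ j) {I : Finset ℕ}
    (hI : I ⊆ Finset.range (C.H j)) {i : ℕ} (hi : i < C.H j) {x : X}
    (hx : x ∈ C.U i (C.E j)) : x ∈ C.Lv j I ↔ i ∈ I := by
  rw [mem_Lv]
  constructor
  · rintro ⟨i', hi', hx'⟩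
    by_contra hne
    have : i ≠ i' := fun h => hne (h ▸ hi')
    exact Set.disjoint_left.1 (C.lev_disj hj hi (Finset.mem_range.1 (hI hi')) this) hx hx'
  · intro h; exact ⟨i, h, hx⟩

theorem Lv_step (C : ChaconMap μ s) {j : ℕ} (hj : 1 ≤ j) {I : Finset ℕ}
    (hI : I ⊆ Finset.range (C.H j)) :
    ∃ I' ⊆ Finset.range (C.H (j + 1)), C.Lv j I =ᵐ[μ] C.Lv (j + 1) I' := by
  classical
  refine ⟨I ∪ I.image (· + C.H j) ∪ I.image (· + (2 * C.H j + s j)), ?_, ?_⟩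
  · intro i hi
    have hH := C.H_succ hj
    simp only [Finset.mem_union, Finset.mem_image] at hi
    rw [Finset.mem_range]
    rcases hi with (hi | ⟨a, ha, rfl⟩) | ⟨a, ha, rfl⟩
    · have := Finset.mem_range.1 (hI hi); omega
    · have := Finset.mem_range.1 (hI ha); omega
    · have := Finset.mem_range.1 (hI ha); omega
  · have h1 : C.Lv j I =ᵐ[μ] ⋃ i ∈ I, C.U i (C.E (j + 1) ∪ C.U (C.H j) (C.E (j + 1)) ∪
        C.U (2 * C.H j + s j) (C.E (j + 1))) :=
      Filter.EventuallyEq.countable_bUnion (I.countable_toSet)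
        (fun i _ => C.U_ae_eq i (C.E_ae hj).symm)
    refine h1.trans (Filter.EventuallyEq.of_eq ?_)
    apply Set.ext
    intro x
    simp only [U_union, U_add, Lv, Set.mem_iUnion, Set.mem_union, Finset.mem_union,
      Finset.mem_image, exists_prop]
    constructor
    · rintro ⟨i, hi, (h | h) | h⟩
      · exact ⟨i, .inl (.inl hi), h⟩
      · exact ⟨_, .inl (.inr ⟨i, hi, rfl⟩), h⟩
      · exact ⟨_, .inr ⟨i, hi, rfl⟩, h⟩
    · rintro ⟨_, (hi | ⟨i, hi, rfl⟩) | ⟨i, hi, rfl⟩, h⟩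
      · exact ⟨_, hi, .inl (.inl h)⟩
      · exact ⟨_, hi, .inl (.inr h)⟩
      · exact ⟨_, hi, .inr h⟩

theorem Lv_steps (C : ChaconMap μ s) {m : ℕ} (hm : 1 ≤ m) {I : Finset ℕ}
    (hI : I ⊆ Finset.range (C.H m)) {j : ℕ} (hj : m ≤ j) :
    ∃ I' ⊆ Finset.range (C.H j), C.Lv m I =ᵐ[μ] C.Lv j I' := by
  induction j, hj using Nat.le_induction with
  | base => exact ⟨I, hI, ae_eq_refl _⟩
  | succ j hmj ih =>
    obtain ⟨I', h1, h2⟩ := ih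
    obtain ⟨I'', h3, h4⟩ := C.Lv_step (hm.trans hmj) h1
    exact ⟨I'', h3, h2.trans h4⟩

/-- Approximable by unions of levels of all high towers. -/
def Appr (C : ChaconMap μ s) (A : Set X) : Prop :=
  ∀ δ : ℝ, 0 < δ → ∃ j0, ∀ j, j0 ≤ j → ∃ I ⊆ Finset.range (C.H j),
    μ.real (A ∆ C.Lv j I) < δ

theorem full (C : ChaconMap μ s) [IsProbabilityMeasure μ] {δ : ℝ} (hδ : 0 < δ) :
    ∃ j0, ∀ j, j0 ≤ j → μ.real (C.Lv j (Finset.range (C.H j)))ᶜ < δ := by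
  have h := C.tower_full
  have h2 := (ENNReal.tendsto_toReal (by simp : (1 : ENNReal) ≠ ⊤)).comp h
  have h3 := h2.eventually (lt_mem_nhds (show 1 - δ < (1 : ENNReal).toReal by simp [hδ]))
  obtain ⟨j0, hj0⟩ := eventually_atTop.1 h3
  refine ⟨j0, fun j hj => ?_⟩
  have h4 : 1 - δ < μ.real (C.Lv j (Finset.range (C.H j))) := hj0 j hj
  rw [probReal_compl_eq_one_sub (C.Lv_meas _ _)]
  linarith

theorem appr_all (C : ChaconMap μ s) [IsProbabilityMeasure μ] {A : Set X}
    (hA : MeasurableSet A) : C.Appr A := by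
  classical
  obtain ⟨B, hB, hAB⟩ := C.generates A hA
  have key : C.Appr B := by
    refine MeasurableSpace.generateFrom_induction _ (fun B _ => C.Appr B) ?_ ?_ ?_ ?_ B hB
    · rintro _ ⟨m, hm, i, hi, rfl⟩ _ δ hδ
      refine ⟨m, fun j hj => ?_⟩
      obtain ⟨I', h1, h2⟩ := C.Lv_steps hm (I := {i})
        (by simp only [Finset.singleton_subset_iff, Finset.mem_range, H]; omega) hj
      refine ⟨I', h1, ?_⟩
      have h3 : C.Lv m {i} = (⇑C.T)^[i] '' C.E m := by simp [Lv, U]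
      rw [h3] at h2
      rw [Measure.real, measure_symmDiff_eq_zero_iff.2 h2]
      simpa
    · intro δ hδ
      exact ⟨0, fun j _ => ⟨∅, by simp, by simpa [Lv] using hδ⟩⟩
    · intro B _ ih δ hδ
      obtain ⟨j1, h1⟩ := ih (δ / 2) (by linarith)
      obtain ⟨j2, h2⟩ := C.full (show 0 < δ / 2 by linarith)
      refine ⟨max (max j1 j2) 1, fun j hj => ?_⟩
      obtain ⟨I, hI, hd⟩ := h1 j (by omega)
      have h3 := h2 j (by omega)
      refine ⟨Finset.range (C.H j) \ I, Finset.sdiff_subset, ?_⟩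
      refine lt_of_le_of_lt (measureReal_mono (s₂ := (B ∆ C.Lv j I) ∪
        (C.Lv j (Finset.range (C.H j)))ᶜ) ?_) ?_
      · intro x hx
        by_cases hxt : x ∈ C.Lv j (Finset.range (C.H j))
        · left
          obtain ⟨i, hi, hxi⟩ := C.mem_Lv.1 hxt
          have hi' := Finset.mem_range.1 hi
          rw [Set.mem_symmDiff, C.mem_Lv_iff (by omega) Finset.sdiff_subset hi' hxi] at hx
          rw [Set.mem_symmDiff, C.mem_Lv_iff (by omega) hI hi' hxi]
          simp only [Set.mem_compl_iff, Finset.mem_sdiff, hi, true_and] at hx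
          tauto
        · exact .inr hxt
      · exact (measureReal_union_le _ _).trans_lt (by linarith)
    · intro B hBm ih δ hδ
      have hfin : ∀ N, C.Appr (⋃ n ∈ Finset.range N, B n) := by
        intro N
        induction N with
        | zero => intro δ hδ; exact ⟨0, fun j _ => ⟨∅, by simp, by simpa [Lv] using hδ⟩⟩
        | succ N ihN =>
          intro δ hδ
          obtain ⟨j1, h1⟩ := ihN (δ / 2) (by linarith)
          obtain ⟨j2, h2⟩ := ih N (δ / 2) (by linarith)
          refine ⟨max j1 j2, fun j hj => ?_⟩
          obtain ⟨I, hI, hd⟩ := h1 j (by omega)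
          obtain ⟨J, hJ, hd'⟩ := h2 j (by omega)
          refine ⟨I ∪ J, Finset.union_subset hI hJ, ?_⟩
          refine lt_of_le_of_lt (measureReal_mono (s₂ := ((⋃ n ∈ Finset.range N, B n) ∆ C.Lv j I) ∪
            (B N ∆ C.Lv j J)) ?_) ((measureReal_union_le _ _).trans_lt
              (show _ < δ by linarith))
          rw [Finset.range_add_one, Finset.set_biUnion_insert, Lv_union]
          intro x
          simp only [Set.mem_symmDiff, Set.mem_union]
          tauto
      have hgen : ∀ n, MeasurableSet (B n) := by
        intro n
        refine MeasurableSpace.generateFrom_le ?_ _ (hBm n)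
        rintro _ ⟨m, hm, i, hi, rfl⟩
        exact C.U_meas i (C.measE m)
      have hmono : Monotone (fun N => ⋃ n ∈ Finset.range N, B n) := by
        intro N M hNM
        exact Set.biUnion_subset_biUnion_left (by simpa using hNM)
      have hlim := tendsto_measure_iUnion_atTop (μ := μ) hmono
      have heq : (⋃ N, ⋃ n ∈ Finset.range N, B n) = ⋃ n, B n := by
        ext x
        simp only [Set.mem_iUnion, Finset.mem_range, exists_prop]
        exact ⟨fun ⟨_, n, _, h⟩ => ⟨n, h⟩, fun ⟨n, h⟩ => ⟨n + 1, n, by omega, h⟩⟩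
      rw [heq] at hlim
      have h2 := (ENNReal.tendsto_toReal (measure_ne_top μ (⋃ n, B n))).comp hlim
      have h3 := h2.eventually (lt_mem_nhds
        (show μ.real (⋃ n, B n) - δ / 2 < (μ (⋃ n, B n)).toReal by
          simp only [Measure.real]; linarith))
      obtain ⟨N, hN⟩ := h3.exists
      have hN' : μ.real (⋃ n, B n) - δ / 2 < μ.real (⋃ n ∈ Finset.range N, B n) := hN
      obtain ⟨j1, h1⟩ := hfin N (δ / 2) (by linarith)
      refine ⟨j1, fun j hj => ?_⟩
      obtain ⟨I, hI, hd⟩ := h1 j hj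
      refine ⟨I, hI, ?_⟩
      have hsub : (⋃ n ∈ Finset.range N, B n) ⊆ ⋃ n, B n := by
        rw [← heq]; exact Set.subset_iUnion (fun N => ⋃ n ∈ Finset.range N, B n) N
      have hdiff := measureReal_sdiff (μ := μ) hsub
        (Finset.measurableSet_biUnion _ fun n _ => hgen n)
      refine lt_of_le_of_lt (measureReal_mono (s₂ := ((⋃ n ∈ Finset.range N, B n) ∆ C.Lv j I) ∪
        ((⋃ n, B n) \ (⋃ n ∈ Finset.range N, B n))) ?_) ((measureReal_union_le _ _).trans_lt
              (show _ < δ by linarith))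
      intro x hx
      have := @hsub x
      simp only [Set.mem_symmDiff, Set.mem_union, Set.mem_sdiff] at hx ⊢
      tauto
  intro δ hδ
  obtain ⟨j0, h0⟩ := key δ hδ
  refine ⟨j0, fun j hj => ?_⟩
  obtain ⟨I, hI, hd⟩ := h0 j hj
  refine ⟨I, hI, ?_⟩
  have : μ.real (A ∆ B) = 0 := by simp [Measure.real, hAB]
  have := measureReal_symmDiff_le (μ := μ) (s := A) (t := B) (C.Lv j I)
  linarith

theorem inv_U (C : ChaconMap μ s) {A : Set X} (hT : C.U 1 A =ᵐ[μ] A) (i : ℕ) :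
    C.U i A =ᵐ[μ] A := by
  induction i with
  | zero => rw [U_zero]; exact ae_eq_refl _
  | succ i ih =>
    rw [← U_add]
    exact (C.U_ae_eq i hT).trans ih

theorem ergodic_aux (C : ChaconMap μ s) [IsProbabilityMeasure μ] {A : Set X}
    (hA : MeasurableSet A) (hT : C.U 1 A =ᵐ[μ] A) : μ.real A = μ.real A * μ.real A := by
  have key : ∀ δ : ℝ, 0 < δ → |μ.real A - μ.real A * μ.real A| ≤ 4 * δ := by
    intro δ hδ
    obtain ⟨j1, h1⟩ := C.appr_all hA δ hδ
    obtain ⟨j2, h2⟩ := C.full hδ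
    set j := max (max j1 j2) 1 with hjdef
    have hj : 1 ≤ j := by omega
    obtain ⟨I, hI, hd⟩ := h1 j (by omega)
    have hf := h2 j (by omega)
    have hlev : ∀ i, μ.real (A ∩ C.U i (C.E j)) = μ.real (A ∩ C.E j) := by
      intro i
      have h3 : (A ∩ C.U i (C.E j) : Set X) =ᵐ[μ] (C.U i A ∩ C.U i (C.E j) : Set X) :=
        ae_eq_set_inter (C.inv_U hT i).symm (ae_eq_refl _)
      rw [measureReal_congr h3]
      unfold U
      rw [← Set.image_inter (C.inj i)]
      exact C.real_U i _
    have e1 := C.Lv_real_inter hj hI hA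
    have e2 := C.Lv_real_inter hj (Finset.Subset.refl _) hA
    have e3 := C.Lv_real hj hI
    have e4 := C.Lv_real hj (Finset.Subset.refl _)
    simp only [hlev, Finset.sum_const, nsmul_eq_mul, Finset.card_range] at e1 e2 e4
    have prod : μ.real (A ∩ C.Lv j I) * μ.real (C.Lv j (Finset.range (C.H j))) =
        μ.real (A ∩ C.Lv j (Finset.range (C.H j))) * μ.real (C.Lv j I) := by
      rw [e1, e2, e3, e4]; ring
    have hc := probReal_compl_eq_one_sub (μ := μ) (C.Lv_meas j (Finset.range (C.H j)))
    rw [hc] at hf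
    have b1 : |μ.real A - μ.real (C.Lv j I)| ≤ μ.real (A ∆ C.Lv j I) :=
      abs_measureReal_sub_le_measureReal_symmDiff hA.nullMeasurableSet (C.Lv_meas j I).nullMeasurableSet
    have b2 : μ.real A ≤ μ.real (A ∩ C.Lv j I) + μ.real (A ∆ C.Lv j I) := by
      refine (measureReal_mono ?_).trans (measureReal_union_le _ _)
      intro x
      simp only [Set.mem_symmDiff, Set.mem_union, Set.mem_inter_iff]
      tauto
    have b3 : μ.real A ≤ μ.real (A ∩ C.Lv j (Finset.range (C.H j))) +
        μ.real (C.Lv j (Finset.range (C.H j)))ᶜ := by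
      refine (measureReal_mono ?_).trans (measureReal_union_le _ _)
      intro x
      simp only [Set.mem_union, Set.mem_inter_iff, Set.mem_compl_iff]
      tauto
    rw [hc] at b3
    have b4 : μ.real (A ∩ C.Lv j I) ≤ μ.real A := measureReal_mono Set.inter_subset_left
    have b5 : μ.real (A ∩ C.Lv j (Finset.range (C.H j))) ≤ μ.real A :=
      measureReal_mono Set.inter_subset_left
    have p1 : μ.real A ≤ 1 := measureReal_le_one
    have p2 : μ.real (C.Lv j I) ≤ 1 := measureReal_le_one
    have p3 : μ.real (C.Lv j (Finset.range (C.H j))) ≤ 1 := measureReal_le_one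
    have p4 : 0 ≤ μ.real A := measureReal_nonneg
    have p5 : 0 ≤ μ.real (C.Lv j I) := measureReal_nonneg
    have p6 : 0 ≤ μ.real (A ∩ C.Lv j I) := measureReal_nonneg
    have p7 : 0 ≤ μ.real (C.Lv j (Finset.range (C.H j))) := measureReal_nonneg
    generalize μ.real A = a at *
    generalize μ.real (C.Lv j I) = z at *
    generalize μ.real (C.Lv j (Finset.range (C.H j))) = τ at *
    generalize μ.real (A ∩ C.Lv j I) = x at *
    generalize μ.real (A ∩ C.Lv j (Finset.range (C.H j))) = y at *
    have b1' := abs_le.1 b1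
    have q : a - a * a = (a - x) + x * (1 - τ) + ((y - a) * z) + a * (z - a) := by
      linear_combination prod
    have q1 : x * (1 - τ) ≤ δ := by nlinarith
    have q1' : 0 ≤ x * (1 - τ) := mul_nonneg p6 (by linarith)
    have q2 : -δ ≤ (y - a) * z := by nlinarith
    have q2' : (y - a) * z ≤ 0 := mul_nonpos_of_nonpos_of_nonneg (by linarith) p5
    have q3 : -δ ≤ a * (z - a) := by nlinarith
    have q3' : a * (z - a) ≤ δ := by nlinarith
    rw [abs_le]
    constructor <;> linarith
  by_contra hne
  have hpos : 0 < |μ.real A - μ.real A * μ.real A| := abs_pos.2 (sub_ne_zero.2 hne)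
  have := key (|μ.real A - μ.real A * μ.real A| / 8) (by linarith)
  linarith

/-- If the symbols at the source and target levels differ, the piece is a mismatch. -/
theorem mismatch (C : ChaconMap μ s) {j : ℕ} (hj : 1 ≤ j) {I : Finset ℕ}
    (hI : I ⊆ Finset.range (C.H j)) {n i i2 : ℕ} (hi : i < C.H j) (hi2 : i2 < C.H j)
    {G : Set X} (hG : G ⊆ C.E j) (hG2 : C.U n (C.U i G) ≤ᵐ[μ] C.U i2 (C.E j))
    (hne : ¬ (i ∈ I ↔ i2 ∈ I)) :
    C.U n (C.U i G) ≤ᵐ[μ] ((C.Lv j I) ∆ (C.U n (C.Lv j I)) : Set X) := by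
  filter_upwards [hG2] with x hx hxG
  have hx2 : x ∈ C.U i2 (C.E j) := hx hxG
  have h1 := C.mem_Lv_iff hj hI hi2 hx2
  obtain ⟨y, hy, rfl⟩ := hxG
  have h2 := C.mem_Lv_iff hj hI hi (C.U_mono i hG hy)
  have h3 : (⇑C.T)^[n] y ∈ C.U n (C.Lv j I) ↔ y ∈ C.Lv j I := (C.inj n).mem_set_image
  change _ ∈ ((C.Lv j I) ∆ (C.U n (C.Lv j I)) : Set X)
  rw [Set.mem_symmDiff, h1, h3, h2]
  tauto

theorem count (C : ChaconMap μ (fun j => j)) [IsProbabilityMeasure μ] {k j : ℕ} (hk : 1 ≤ k)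
    (hjk : j = k + 1) {n t : ℕ}
    (ht : ∀ v < C.H k, n ≤ t + v + C.H j + j + 1 ∧ t + v + C.H j + j + 1 < n + C.H j ∧
      t + v + 1 < C.H j)
    {I : Finset ℕ} (hI : I ⊆ Finset.range (C.H j)) {b : Finset ℕ}
    (hb : ∀ v ∈ b, ∃ w < C.H k, v = t + w ∧ ¬ (v ∈ I ↔ v + 1 ∈ I)) :
    b.card * μ.real (C.E j) ≤ 9 * μ.real ((C.Lv j I) ∆ (C.U n (C.Lv j I))) := by
  classical
  have hj : 1 ≤ j := by omega
  have hj1 : 1 ≤ j + 1 := by omega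
  set F : Set X := C.U (2 * C.H j + j) (C.E2 (j + 1)) with hF
  have hFE : F ≤ᵐ[μ] C.E j := by
    have h1 : F ⊆ C.U (2 * C.H j + j) (C.E (j + 1)) := C.U_mono _ (C.E2_sub hj1)
    have h2 := (C.E3_ae hj).le
    exact (LE.le.eventuallyLE h1).trans
      (h2.trans (LE.le.eventuallyLE (C.E3_sub hj)))
  have hF2 : C.U (C.H j + j + 1) F ≤ᵐ[μ] C.E j := by
    rw [hF, U_add]
    have hH : C.H j + j + 1 + (2 * C.H j + j) = C.H (j + 1) + (j + 1) := by
      rw [C.H_succ hj]; omega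
    rw [hH]
    exact (C.E3_ae' hj1).le.trans (LE.le.eventuallyLE
      ((C.E3_sub hj1).trans (C.E1_sub hj)))
  have hFm : MeasurableSet F := C.U_meas _ (C.measE2 _)
  have hFr : μ.real (F ∩ C.E j) = μ.real (C.E j) / 9 := by
    have : (F ∩ C.E j : Set X) =ᵐ[μ] F := by
      rw [ae_eq_set]
      refine ⟨by simp [Set.sdiff_eq_empty.2 Set.inter_subset_left], ?_⟩
      rw [Set.sdiff_self_inter]
      exact ae_le_set.1 hFE
    rw [measureReal_congr this, hF, real_U, C.real_E2 hj1, C.real_E hj, C.real_E hj1]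
    ring
  have hE2r : μ.real (C.E2 j) = μ.real (C.E j) / 3 := by
    rw [C.real_E2 hj, C.real_E hj]; ring
  let src : ℕ → ℕ := fun v => v + C.H j + j + 1 - n
  let P : ℕ → Set X := fun v => if (src v ∈ I ↔ v + 1 ∈ I) then F ∩ C.E j else C.E2 j
  let G : ℕ → Set X := fun v => C.U n (C.U (src v) (P v))
  have hPE : ∀ v, P v ⊆ C.E j := by
    intro v
    simp only [P]
    split_ifs
    · exact Set.inter_subset_right
    · exact C.E2_sub hj
  have hPm : ∀ v, MeasurableSet (P v) := by
    intro v
    simp only [P]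
    split_ifs
    · exact hFm.inter (C.measE j)
    · exact C.measE2 j
  have hPr : ∀ v, μ.real (C.E j) / 9 ≤ μ.real (G v) := by
    intro v
    simp only [G, real_U, P]
    have : 0 ≤ μ.real (C.E j) := measureReal_nonneg
    split_ifs
    · rw [hFr]
    · rw [hE2r]; linarith
  have hGb : ∀ v ∈ b, G v ≤ᵐ[μ] ((C.Lv j I) ∆ (C.U n (C.Lv j I)) : Set X) := by
    intro v hv
    obtain ⟨w, hw, hvw, hbad⟩ := hb v hv
    obtain ⟨c1, c2, c3⟩ := ht w hw
    have hsrc : src v < C.H j := by simp only [src]; omega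
    by_cases hcase : (src v ∈ I ↔ v + 1 ∈ I)
    · refine C.mismatch hj hI hsrc (i2 := v) (by omega) (hPE v) ?_ (by tauto)
      have e : P v = F ∩ C.E j := if_pos hcase
      rw [e, U_add]
      refine (C.U_ae_le _ (LE.le.eventuallyLE Set.inter_subset_left)).trans ?_
      have e2 : n + src v = v + (C.H j + j + 1) := by simp only [src]; omega
      rw [e2, ← U_add]
      exact C.U_ae_le v hF2
    · refine C.mismatch hj hI hsrc (i2 := v + 1) (by omega) (hPE v) ?_ hcase
      have e : P v = C.E2 j := if_neg hcase
      rw [e, U_add]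
      have e2 : n + src v = (v + 1) + (C.H j + j) := by simp only [src]; omega
      rw [e2, ← U_add]
      exact C.U_ae_le (v + 1) ((C.E3_ae' hj).le.trans
        (LE.le.eventuallyLE (C.E3_sub hj)))
  have hdisj : (b : Set ℕ).PairwiseDisjoint G := by
    intro v hv v' hv' hne
    obtain ⟨w, hw, hvw, -⟩ := hb v hv
    obtain ⟨w', hw', hvw', -⟩ := hb v' hv'
    obtain ⟨c1, c2, c3⟩ := ht w hw
    obtain ⟨c1', c2', c3'⟩ := ht w' hw'
    refine C.U_disj n ((C.lev_disj hj (i := src v) (i' := src v') ?_ ?_ ?_).mono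
      (C.U_mono _ (hPE v)) (C.U_mono _ (hPE v')))
    all_goals simp only [src]; omega
  have hsum := measureReal_biUnion_finset (μ := μ) hdisj
    (fun v _ => C.U_meas n (C.U_meas (src v) (hPm v)))
  have hle : (⋃ v ∈ b, G v) ≤ᵐ[μ] ((C.Lv j I) ∆ (C.U n (C.Lv j I)) : Set X) := by
    rw [ae_le_set]
    refine measure_mono_null (t := ⋃ v ∈ b, (G v \ ((C.Lv j I) ∆ (C.U n (C.Lv j I))))) ?_ ?_
    · rintro x ⟨hx, hx'⟩
      simp only [Set.mem_iUnion] at hx ⊢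
      obtain ⟨v, hv, hxv⟩ := hx
      exact ⟨v, hv, hxv, hx'⟩
    · refine (measure_biUnion_null_iff b.countable_toSet).2 ?_
      intro v hv
      exact ae_le_set.1 (hGb v hv)
  have hle2 : μ.real (⋃ v ∈ b, G v) ≤ μ.real ((C.Lv j I) ∆ (C.U n (C.Lv j I))) :=
    ENNReal.toReal_mono (measure_ne_top _ _) (measure_mono_ae hle)
  have hle3 : ∑ v ∈ b, μ.real (C.E j) / 9 ≤ ∑ v ∈ b, μ.real (G v) :=
    Finset.sum_le_sum fun v _ => hPr v
  rw [Finset.sum_const, nsmul_eq_mul] at hle3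
  linarith

theorem local_bound (C : ChaconMap μ (fun j => j)) [IsProbabilityMeasure μ] {A : Set X}
    {k j : ℕ} (hk : 1 ≤ k) (hjk : j = k + 1) {n : ℕ} (hn1 : C.H k + j + 1 ≤ n)
    (hn2 : n ≤ 4 * C.H k + 2 * j) {δ : ℝ} {I J : Finset ℕ}
    (hI : I ⊆ Finset.range (C.H j)) (hJ : J ⊆ Finset.range (C.H k))
    (hdI : μ.real (A ∆ C.Lv j I) < δ)
    (hdJ : μ.real ((A ∆ (C.T ⁻¹' A)) ∆ C.Lv k J) < δ) :
    μ.real (A ∆ (C.T ⁻¹' A)) ≤ 27 * μ.real (A ∆ C.U n A) + 64 * δ := by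
  classical
  have hj : 1 ≤ j := by omega
  have hH : C.H j = 3 * C.H k + k := by rw [hjk]; exact C.H_succ hk
  have hHpos : 1 ≤ C.H k := by unfold H; omega
  obtain ⟨t, ht0, ht⟩ : ∃ t, (t = 0 ∨ t = C.H k) ∧
      ∀ v < C.H k, n ≤ t + v + C.H j + j + 1 ∧ t + v + C.H j + j + 1 < n + C.H j ∧
      t + v + 1 < C.H j := by
    by_cases h : n ≤ C.H j + j + 1
    · exact ⟨0, .inl rfl, fun v hv => by omega⟩
    · exact ⟨C.H k, .inr rfl, fun v hv => by omega⟩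
  have htE : C.U t (C.E j) ≤ᵐ[μ] C.E k := by
    rcases ht0 with rfl | rfl
    · rw [U_zero, hjk]; exact LE.le.eventuallyLE (C.E1_sub hk)
    · rw [hjk]
      exact (C.E2_ae hk).le.trans (LE.le.eventuallyLE (C.E2_sub hk))
  set D : Set X := A ∆ (C.T ⁻¹' A) with hD
  set W : Finset ℕ := (Finset.range (C.H k)).image (t + ·) with hW
  set b : Finset ℕ := W.filter (fun v => ¬ (v ∈ I ↔ v + 1 ∈ I)) with hbdef
  have hWr : W ⊆ Finset.range (C.H j) := by
    intro v hv
    obtain ⟨w, hw, rfl⟩ := Finset.mem_image.1 hv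
    have := ht w (Finset.mem_range.1 hw)
    rw [Finset.mem_range]; omega
  have hbr : b ⊆ Finset.range (C.H j) := (Finset.filter_subset _ _).trans hWr
  have hcount := C.count hk hjk ht hI (b := b) (by
    intro v hv
    obtain ⟨h1, h2⟩ := Finset.mem_filter.1 hv
    obtain ⟨w, hw, rfl⟩ := Finset.mem_image.1 h1
    exact ⟨w, Finset.mem_range.1 hw, rfl, h2⟩)
  rw [← C.Lv_real hj hbr] at hcount
  -- upper bound
  have hup : μ.real (D ∩ C.Lv j W) ≤ μ.real (A ∆ C.Lv j I) + μ.real (A ∆ C.Lv j I) +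
      μ.real (C.Lv j b) := by
    have hpre : μ.real (C.T ⁻¹' (A ∆ C.Lv j I)) = μ.real (A ∆ C.Lv j I) := by
      simp only [Measure.real, C.measurePreserving.measure_preimage_equiv]
    have hsub : D ∩ C.Lv j W ⊆ ((A ∆ C.Lv j I) ∪ (C.T ⁻¹' (A ∆ C.Lv j I))) ∪ C.Lv j b := by
      rintro x ⟨hxD, hxW⟩
      obtain ⟨v, hv, hxv⟩ := C.mem_Lv.1 hxW
      have hvr := Finset.mem_range.1 (hWr hv)
      have hv1 : v + 1 < C.H j := by
        obtain ⟨w, hw, rfl⟩ := Finset.mem_image.1 hv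
        exact (ht w (Finset.mem_range.1 hw)).2.2
      have hTx : C.T x ∈ C.U (v + 1) (C.E j) := by
        rw [add_comm, ← U_add, U_one]; exact Set.mem_image_of_mem _ hxv
      have m1 := C.mem_Lv_iff hj hI hvr hxv
      have m2 := C.mem_Lv_iff hj hI hv1 hTx
      have m3 := C.mem_Lv_iff hj hbr hvr hxv
      have m4 : v ∈ b ↔ ¬ (v ∈ I ↔ v + 1 ∈ I) := by
        simp only [hbdef, Finset.mem_filter, hv, true_and]
      rw [hD] at hxD
      simp only [Set.mem_symmDiff, Set.mem_union, Set.mem_preimage, m1, m2, m3, m4] at hxD ⊢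
      clear * - hxD
      tauto
    calc _ ≤ _ := measureReal_mono hsub
      _ ≤ _ := measureReal_union_le _ _
      _ ≤ _ := by
        have := measureReal_union_le (μ := μ) (A ∆ C.Lv j I) (C.T ⁻¹' (A ∆ C.Lv j I))
        linarith
  -- lower bound
  set J' : Finset ℕ := J.image (t + ·) with hJ'
  have hJW : J' ⊆ W := Finset.image_subset_image hJ
  have hlow1 : C.Lv j J' ≤ᵐ[μ] (C.Lv k J ∩ C.Lv j W : Set X) := by
    rw [ae_le_set]
    refine measure_mono_null (t := ⋃ i ∈ J, (C.U i (C.U t (C.E j)) \ C.U i (C.E k))) ?_ ?_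
    · rintro x ⟨hx, hx'⟩
      obtain ⟨v, hv, hxv⟩ := C.mem_Lv.1 hx
      have hxW : x ∈ C.Lv j W := C.mem_Lv.2 ⟨v, hJW hv, hxv⟩
      obtain ⟨i, hi, rfl⟩ := Finset.mem_image.1 hv
      simp only [Set.mem_iUnion]
      refine ⟨i, hi, ?_, ?_⟩
      · rw [U_add, add_comm]; exact hxv
      · intro h
        exact hx' ⟨C.mem_Lv.2 ⟨i, hi, h⟩, hxW⟩
    · refine (measure_biUnion_null_iff J.countable_toSet).2 ?_
      intro i _
      exact ae_le_set.1 (C.U_ae_le i htE)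
  have hlow2 : μ.real (C.Lv j J') ≤ μ.real (C.Lv k J ∩ C.Lv j W) :=
    ENNReal.toReal_mono (measure_ne_top _ _) (measure_mono_ae hlow1)
  have hcard : J'.card = J.card := Finset.card_image_of_injective _ (add_right_injective t)
  have hkj : μ.real (C.E k) = 3 * μ.real (C.E j) := by rw [hjk]; exact C.real_E hk
  rw [C.Lv_real hj (hJW.trans hWr), hcard] at hlow2
  have hJr := C.Lv_real hk hJ
  rw [hkj] at hJr
  have c1 : μ.real (C.Lv k J ∩ C.Lv j W) ≤ μ.real (D ∩ C.Lv j W) + μ.real (D ∆ C.Lv k J) := by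
    refine (measureReal_mono ?_).trans (measureReal_union_le _ _)
    intro x
    simp only [Set.mem_symmDiff, Set.mem_union, Set.mem_inter_iff]
    tauto
  have c2 : μ.real D ≤ μ.real (C.Lv k J) + μ.real (D ∆ C.Lv k J) := by
    refine (measureReal_mono ?_).trans (measureReal_union_le _ _)
    intro x
    simp only [Set.mem_symmDiff, Set.mem_union]
    tauto
  -- triangle
  have d1 := measureReal_symmDiff_le (μ := μ) (s := C.Lv j I) (t := A) (C.U n (C.Lv j I))
  have d2 := measureReal_symmDiff_le (μ := μ) (s := A) (t := C.U n A) (C.U n (C.Lv j I))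
  have d3 : μ.real (C.U n A ∆ C.U n (C.Lv j I)) = μ.real (A ∆ C.Lv j I) := by
    rw [← U_symmDiff, real_U]
  rw [symmDiff_comm (C.Lv j I) A] at d1
  linarith

theorem find_k (C : ChaconMap μ (fun j => j)) {K : ℕ} (hK : 1 ≤ K) {n : ℕ}
    (hn : C.H K + K + 2 ≤ n) :
    ∃ k, K ≤ k ∧ C.H k + k + 2 ≤ n ∧ n < C.H (k + 1) + k + 3 := by
  induction n, hn using Nat.le_induction with
  | base =>
    refine ⟨K, le_rfl, le_rfl, ?_⟩
    rw [C.H_succ hK]; omega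
  | succ n hn ih =>
    obtain ⟨k, h1, h2, h3⟩ := ih
    by_cases h : n + 1 < C.H (k + 1) + k + 3
    · exact ⟨k, h1, by omega, h⟩
    · refine ⟨k + 1, by omega, by omega, ?_⟩
      rw [C.H_succ (j := k + 1) (by omega)]; omega

end ChaconMap

/-- the linear Chacon map is mildly mixing. -/
theorem linearChacon_mildlyMixing
    {X : Type*} [MeasurableSpace X] (μ : Measure X) [IsProbabilityMeasure μ]
    (C : ChaconMap μ (fun j => j)) :
    ∀ A : Set X, MeasurableSet A → 0 < μ A → μ A < 1 →
      limsup (fun n => μ (A ∩ (⇑C.T)^[n] '' A)) atTop < μ A := by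
  intro A hA h0 h1
  by_contra hcon
  rw [not_lt] at hcon
  have hDm : MeasurableSet (A ∆ (C.T ⁻¹' A)) := hA.symmDiff (C.T.measurable hA)
  have hfreq : ∀ ε : ℝ, 0 < ε → ∃ᶠ n in atTop, μ.real (A ∆ C.U n A) ≤ 2 * ε := by
    intro ε hε
    have hlt : μ A - ENNReal.ofReal ε < limsup (fun n => μ (A ∩ (⇑C.T)^[n] '' A)) atTop :=
      lt_of_lt_of_le (ENNReal.sub_lt_self (measure_ne_top _ _) h0.ne'
        (by simpa using hε)) hcon
    refine (frequently_lt_of_lt_limsup (by isBoundedDefault) hlt).mono ?_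
    intro n hn
    have hn1 : μ A ≤ μ (A ∩ C.U n A) + ENNReal.ofReal ε := tsub_le_iff_right.1 hn.le
    have hn2 : μ.real A ≤ μ.real (A ∩ C.U n A) + ε := by
      have := ENNReal.toReal_mono (by finiteness) hn1
      rwa [ENNReal.toReal_add (by finiteness) (by finiteness), ENNReal.toReal_ofReal hε.le] at this
    have e1 := measureReal_inter_add_sdiff (μ := μ) (s := A) (C.U_meas n hA)
    have e2 := measureReal_inter_add_sdiff (μ := μ) (s := C.U n A) hA
    rw [C.real_U, Set.inter_comm] at e2
    have e3 := measureReal_union_le (μ := μ) (A \ C.U n A) (C.U n A \ A)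
    have e4 : A ∆ C.U n A = (A \ C.U n A) ∪ (C.U n A \ A) := rfl
    rw [e4]
    linarith
  have hD0 : ∀ δ : ℝ, 0 < δ → μ.real (A ∆ (C.T ⁻¹' A)) ≤ 118 * δ := by
    intro δ hδ
    obtain ⟨j1, hj1⟩ := C.appr_all hA δ hδ
    obtain ⟨j2, hj2⟩ := C.appr_all hDm δ hδ
    set K := max (max j1 j2) 1 with hK
    obtain ⟨n, hn, hnA⟩ := frequently_atTop.1 (hfreq δ hδ) (C.H K + K + 2)
    obtain ⟨k, hk1, hk2, hk3⟩ := C.find_k (by omega) hn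
    have hk : 1 ≤ k := by omega
    obtain ⟨I, hI, hdI⟩ := hj1 (k + 1) (by omega)
    obtain ⟨J, hJ, hdJ⟩ := hj2 k (by omega)
    have hHs := C.H_succ hk
    have := C.local_bound hk rfl (n := n) (by omega) (by omega) hI hJ hdI hdJ
    linarith
  have hDz : μ.real (A ∆ (C.T ⁻¹' A)) = 0 := by
    by_contra hne
    have hp : 0 < μ.real (A ∆ (C.T ⁻¹' A)) := lt_of_le_of_ne measureReal_nonneg (Ne.symm hne)
    have := hD0 (μ.real (A ∆ (C.T ⁻¹' A)) / 200) (by linarith)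
    linarith
  have hDz' : μ (A ∆ (C.T ⁻¹' A)) = 0 := (measureReal_eq_zero_iff).1 hDz
  have hae := C.U_ae_eq 1 (measure_symmDiff_eq_zero_iff.1 hDz')
  have hpre : C.U 1 (C.T ⁻¹' A) = A := by
    rw [C.U_one]; exact Set.image_preimage_eq A C.T.surjective
  rw [hpre] at hae
  have herg := C.ergodic_aux hA hae
  have hr0 : 0 < μ.real A := ENNReal.toReal_pos h0.ne' (measure_ne_top _ _)
  have hr1 : μ.real A < 1 := by
    have := (ENNReal.toReal_lt_toReal (measure_ne_top μ A) ENNReal.one_ne_top).2 h1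
    rwa [ENNReal.toReal_one] at this
  nlinarith
end

section
/- The linear Chacon map T has no nontrivial factors: every sub-σ-algebra F ⊆ 𝒜 satisfying T^{-1}F = F (mod μ-null sets) is either trivial mod μ (every set in F has measure 0 or 1) or equal to 𝒜 mod μ. -/
open MeasureTheory Filter Topology
open scoped symmDiff

/-- Tower sizes (number of levels). -/
def HH : ℕ → ℤ
  | 0 => 1
  | 1 => 2
  | (n + 2) => 3 * HH (n + 1) + (n + 1)

theorem HH_succ (j : ℕ) (hj : 1 ≤ j) : HH (j + 1) = 3 * HH j + j := by
  obtain ⟨k, rfl⟩ : ∃ k, j = k + 1 := ⟨j - 1, by omega⟩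
  simp [HH]

theorem HH_ge (j : ℕ) : (j : ℤ) + 1 ≤ HH j := by
  induction j with
  | zero => simp [HH]
  | succ k ih =>
    rcases Nat.eq_zero_or_pos k with rfl | hk
    · simp [HH]
    · rw [HH_succ k hk]; push_cast; omega

theorem HH_ge5 (j : ℕ) (hj : 3 ≤ j) : (j : ℤ) + 5 ≤ HH j := by
  induction j, hj using Nat.le_induction with
  | base => simp [HH]
  | succ k hk ih => rw [HH_succ k (by omega)]; push_cast; omega

theorem HH_pos (j : ℕ) : 0 < HH j := by have := HH_ge j; omega

theorem HH_lt_succ (j : ℕ) : HH j < HH (j + 1) := by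
  rcases Nat.eq_zero_or_pos j with rfl | hk
  · simp [HH]
  · rw [HH_succ j hk]; have := HH_pos j; omega

theorem HH_strictMono : StrictMono HH := strictMono_nat_of_lt_succ HH_lt_succ

theorem HH_add (j n : ℕ) (hj : 1 ≤ j) : 3 ^ n * HH j ≤ HH (j + n) := by
  induction n with
  | zero => simp
  | succ k ih =>
    rw [← add_assoc, HH_succ (j + k) (by omega), pow_succ]; push_cast; nlinarith

theorem HH_le_pow (j : ℕ) (hj : 1 ≤ j) : 4 * HH j + 2 * j + 1 ≤ 4 * 3 ^ j := by
  induction j, hj using Nat.le_induction with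
  | base => simp [HH]
  | succ k hk ih => rw [HH_succ k hk, pow_succ]; push_cast; linarith

/-- Mismatch set of a word with its shift by `e`. -/
noncomputable def misSet (w : ℤ → Bool) (H e : ℤ) : Finset ℤ :=
  (Finset.Ico 0 H).filter (fun i => 0 ≤ i + e ∧ i + e < H ∧ w i ≠ w (i + e))

noncomputable def mis (w : ℤ → Bool) (H e : ℤ) : ℕ := (misSet w H e).card

theorem mem_misSet {w : ℤ → Bool} {H e i : ℤ} :
    i ∈ misSet w H e ↔ 0 ≤ i ∧ i < H ∧ 0 ≤ i + e ∧ i + e < H ∧ w i ≠ w (i + e) := by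
  simp [misSet, and_assoc]

theorem mis_zero (w : ℤ → Bool) (H : ℤ) : mis w H 0 = 0 := by
  simp [mis, misSet]

theorem mis_neg (w : ℤ → Bool) (H e : ℤ) : mis w H (-e) = mis w H e := by
  have key : ∀ e, mis w H (-e) ≤ mis w H e := by
    intro e
    unfold mis
    apply Finset.card_le_card_of_injOn (fun i => i - e)
    · intro i hi
      have hi := mem_misSet.1 (Finset.mem_coe.1 hi)
      apply Finset.mem_coe.2
      rw [mem_misSet]
      have h1 : i + -e = i - e := by ring
      have h2 : i - e + e = i := by ring
      rw [h1] at hi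
      simp only [h2]
      exact ⟨hi.2.2.1, hi.2.2.2.1, hi.1, hi.2.1, fun h => hi.2.2.2.2 h.symm⟩
    · intro a _ b _ hab
      simpa using hab
  apply le_antisymm (key e)
  have := key (-e)
  rwa [neg_neg] at this

theorem mis_le (w : ℤ → Bool) (H e : ℤ) (hH : 0 ≤ H) : (mis w H e : ℤ) ≤ H := by
  have : mis w H e ≤ (Finset.Ico 0 H).card := Finset.card_filter_le _ _
  rw [Int.card_Ico] at this
  omega

theorem mis_le_sub (w : ℤ → Bool) (H e : ℤ) (heH : e ≤ H) :
    (mis w H e : ℤ) ≤ H - e := by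
  have : mis w H e ≤ (Finset.Ico 0 (H - e)).card := by
    apply Finset.card_le_card
    intro i hi
    rw [mem_misSet] at hi
    rw [Finset.mem_Ico]; omega
  rw [Int.card_Ico] at this
  omega

/-- `w` occurs in `w'` at position `a`. -/
def Occ (w : ℤ → Bool) (H : ℤ) (w' : ℤ → Bool) (H' : ℤ) (a : ℤ) : Prop :=
  0 ≤ a ∧ a + H ≤ H' ∧ ∀ i, 0 ≤ i → i < H → w' (i + a) = w i

theorem Occ.trans {w w' w'' : ℤ → Bool} {H H' H'' a b : ℤ}
    (h1 : Occ w H w' H' a) (h2 : Occ w' H' w'' H'' b) : Occ w H w'' H'' (a + b) := by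
  obtain ⟨ha, haH, h1⟩ := h1
  obtain ⟨hb, hbH, h2⟩ := h2
  refine ⟨by omega, by omega, fun i hi hiH => ?_⟩
  rw [← add_assoc, h2 (i + a) (by omega) (by omega), h1 i hi hiH]

theorem occ_image {w w' : ℤ → Bool} {H H' a b e D : ℤ} (ha : Occ w H w' H' a)
    (hb : Occ w H w' H' b) (hD : D = e + b - a) :
    (misSet w H e).image (fun i => i + a) ⊆
      (misSet w' H' D).filter (fun i => a ≤ i ∧ i < a + H) := by
  intro k hk
  obtain ⟨i, hi, rfl⟩ := Finset.mem_image.1 hk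
  rw [mem_misSet] at hi
  obtain ⟨ha0, haH, ha⟩ := ha
  obtain ⟨hb0, hbH, hb⟩ := hb
  rw [Finset.mem_filter, mem_misSet]
  have h1 : i + a + D = i + e + b := by rw [hD]; ring
  rw [h1, ha i hi.1 hi.2.1, hb (i + e) hi.2.2.1 hi.2.2.2.1]
  refine ⟨⟨by omega, by omega, by omega, by omega, hi.2.2.2.2⟩, by omega, by omega⟩

theorem card_misSet_image (w : ℤ → Bool) (H e a : ℤ) :
    ((misSet w H e).image (fun i => i + a)).card = mis w H e :=
  Finset.card_image_of_injective _ (add_left_injective a)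

theorem mis_one_block {w w' : ℤ → Bool} {H H' a b e D : ℤ} (ha : Occ w H w' H' a)
    (hb : Occ w H w' H' b) (hD : D = e + b - a) : mis w H e ≤ mis w' H' D := by
  rw [← card_misSet_image w H e a]
  exact Finset.card_le_card ((occ_image ha hb hD).trans (Finset.filter_subset _ _))

theorem mis_two_blocks {w w' : ℤ → Bool} {H H' a b a' b' e e' D : ℤ} (ha : Occ w H w' H' a)
    (hb : Occ w H w' H' b) (hD : D = e + b - a) (ha' : Occ w H w' H' a')
    (hb' : Occ w H w' H' b') (hD' : D = e' + b' - a') (hlt : a + H ≤ a') :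
    mis w H e + mis w H e' ≤ mis w' H' D := by
  rw [← card_misSet_image w H e a, ← card_misSet_image w H e' a', ← Finset.card_union_of_disjoint]
  · apply Finset.card_le_card
    apply Finset.union_subset
    · exact ((occ_image ha hb hD).trans (Finset.filter_subset _ _))
    · exact ((occ_image ha' hb' hD').trans (Finset.filter_subset _ _))
  · rw [Finset.disjoint_left]
    intro k hk hk'
    have h1 := (Finset.mem_filter.1 (occ_image ha hb hD hk)).2
    have h2 := (Finset.mem_filter.1 (occ_image ha' hb' hD' hk')).2
    omega

theorem mis_three_blocks {w w' : ℤ → Bool} {H H' a b c e : ℤ} (ha : Occ w H w' H' a)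
    (hb : Occ w H w' H' b) (hc : Occ w H w' H' c) (hab : a + H ≤ b) (hbc : b + H ≤ c) :
    3 * mis w H e ≤ mis w' H' e := by
  have h1 := occ_image (e := e) (D := e) ha ha (by ring)
  have h2 := occ_image (e := e) (D := e) hb hb (by ring)
  have h3 := occ_image (e := e) (D := e) hc hc (by ring)
  have : 3 * mis w H e = ((misSet w H e).image (fun i => i + a) ∪
      (misSet w H e).image (fun i => i + b) ∪ (misSet w H e).image (fun i => i + c)).card := by
    rw [Finset.card_union_of_disjoint, Finset.card_union_of_disjoint, card_misSet_image,
      card_misSet_image, card_misSet_image]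
    · ring
    · rw [Finset.disjoint_left]
      intro k hk hk'
      have h1 := (Finset.mem_filter.1 (h1 hk)).2
      have h2 := (Finset.mem_filter.1 (h2 hk')).2
      omega
    · rw [Finset.disjoint_left]
      intro k hk hk'
      have h3 := (Finset.mem_filter.1 (h3 hk')).2
      rcases Finset.mem_union.1 hk with hk | hk
      · have h1 := (Finset.mem_filter.1 (h1 hk)).2
        omega
      · have h2 := (Finset.mem_filter.1 (h2 hk)).2
        omega
  rw [this]
  apply Finset.card_le_card
  refine Finset.union_subset (Finset.union_subset ?_ ?_) ?_
  · exact h1.trans (Finset.filter_subset _ _)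
  · exact h2.trans (Finset.filter_subset _ _)
  · exact h3.trans (Finset.filter_subset _ _)

/-- If a word matches itself under shifts `e` and `e - t`, then its initial or final sub-block
matches itself under the shift `t`. -/
theorem mis_shift_diff {v w : ℤ → Bool} {h H e t : ℤ} (hpre : Occ v h w H 0)
    (hsuf : Occ v h w H (H - h)) (ht : 0 ≤ t) (he : |e| ≤ H - h) :
    mis v h t ≤ mis w H e + mis w H (e - t) := by
  have key : ∀ a, Occ v h w H a → (∀ k, 0 ≤ k → k + t < h →
      0 ≤ k + a + t - e ∧ k + a + t - e < H) → mis v h t ≤ mis w H e + mis w H (e - t) := by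
    intro a ha hk
    rw [← card_misSet_image v h t (a + t - e)]
    refine le_trans ?_ (Finset.card_union_le (misSet w H e) (misSet w H (e - t)))
    apply Finset.card_le_card
    intro i hi
    obtain ⟨k, hk', rfl⟩ := Finset.mem_image.1 hi
    rw [mem_misSet] at hk'
    obtain ⟨k0, kh, k1, k2, k3⟩ := hk'
    have := hk k k0 k2
    obtain ⟨ha0, haH, ha⟩ := ha
    have e1 := ha k k0 kh
    have e2 := ha (k + t) k1 k2
    rw [Finset.mem_union, mem_misSet, mem_misSet]
    have r1 : k + (a + t - e) + e = k + t + a := by ring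
    have r2 : k + (a + t - e) + (e - t) = k + a := by ring
    rw [r1, r2, e1, e2]
    by_cases hw : w (k + (a + t - e)) = v k
    · left
      refine ⟨by omega, by omega, by omega, by omega, ?_⟩
      rw [hw]; exact k3
    · right
      exact ⟨by omega, by omega, by omega, by omega, hw⟩
  rw [abs_le] at he
  rcases le_total 0 e with h0 | h0
  · exact key _ hsuf (fun k hk hkt => ⟨by omega, by omega⟩)
  · exact key _ hpre (fun k hk hkt => ⟨by omega, by omega⟩)

/-- Compatible family of words from stage `j0` on. -/
def Compat (w : ℕ → ℤ → Bool) (j0 : ℕ) : Prop :=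
  ∀ j, j0 ≤ j → ∀ i, 0 ≤ i → i < HH j → w (j + 1) i = w j i ∧ w (j + 1) (i + HH j) = w j i ∧
    w (j + 1) (i + (2 * HH j + j)) = w j i

theorem Compat.mono {w : ℕ → ℤ → Bool} {j0 j1 : ℕ} (h : Compat w j0) (hj : j0 ≤ j1) :
    Compat w j1 := fun j hj' => h j (hj.trans hj')

section
set_option linter.unusedVariables false

theorem occ1 {w : ℕ → ℤ → Bool} {j0 : ℕ} (hw : Compat w j0) (h0 : 1 ≤ j0)
    {j : ℕ} (hj : j0 ≤ j) : Occ (w j) (HH j) (w (j+1)) (HH (j+1)) 0 := by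
  have := HH_succ j (by omega); have := HH_pos j
  exact ⟨le_refl _, by omega, fun i h1 h2 => by simpa using (hw j hj i h1 h2).1⟩

theorem occ2 {w : ℕ → ℤ → Bool} {j0 : ℕ} (hw : Compat w j0) (h0 : 1 ≤ j0)
    {j : ℕ} (hj : j0 ≤ j) : Occ (w j) (HH j) (w (j+1)) (HH (j+1)) (HH j) := by
  have := HH_succ j (by omega); have := HH_pos j
  exact ⟨by omega, by omega, fun i h1 h2 => (hw j hj i h1 h2).2.1⟩

theorem occ3 {w : ℕ → ℤ → Bool} {j0 : ℕ} (hw : Compat w j0) (h0 : 1 ≤ j0)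
    {j : ℕ} (hj : j0 ≤ j) :
    Occ (w j) (HH j) (w (j+1)) (HH (j+1)) (2 * HH j + j) := by
  have := HH_succ j (by omega); have := HH_pos j
  exact ⟨by omega, by omega, fun i h1 h2 => (hw j hj i h1 h2).2.2⟩

theorem occ_pre {w : ℕ → ℤ → Bool} {j0 : ℕ} (hw : Compat w j0) (h0 : 1 ≤ j0)
    {j : ℕ} (hj : j0 ≤ j) (n : ℕ) :
    Occ (w j) (HH j) (w (j+n)) (HH (j+n)) 0 := by
  induction n with
  | zero => exact ⟨le_refl _, by simp, fun i _ _ => by simp⟩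
  | succ k ih =>
    have := ih.trans (occ1 hw h0 (j := j + k) (by omega))
    rwa [add_zero] at this

theorem occ_suf {w : ℕ → ℤ → Bool} {j0 : ℕ} (hw : Compat w j0) (h0 : 1 ≤ j0)
    {j : ℕ} (hj : j0 ≤ j) (n : ℕ) :
    Occ (w j) (HH j) (w (j+n)) (HH (j+n)) (HH (j+n) - HH j) := by
  induction n with
  | zero => exact ⟨by simp, by simp, fun i _ _ => by simp⟩
  | succ k ih =>
    have := ih.trans (occ3 hw h0 (j := j + k) (by omega))
    have e : HH (j + k) - HH j + (2 * HH (j + k) + ((j + k : ℕ) : ℤ)) = HH (j + (k+1)) - HH j := by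
      rw [← add_assoc j k 1, HH_succ (j+k) (by omega)]; ring
    rwa [e] at this

theorem mis_triple {w : ℕ → ℤ → Bool} {j0 : ℕ} (hw : Compat w j0) (h0 : 1 ≤ j0)
    {j : ℕ} (hj : j0 ≤ j) (e : ℤ) :
    3 * mis (w j) (HH j) e ≤ mis (w (j+1)) (HH (j+1)) e :=
  mis_three_blocks (occ1 hw h0 hj) (occ2 hw h0 hj) (occ3 hw h0 hj) (by omega)
    (by have := HH_pos j; omega)

theorem mis_pow {w : ℕ → ℤ → Bool} {j0 : ℕ} (hw : Compat w j0) (h0 : 1 ≤ j0)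
    {j : ℕ} (hj : j0 ≤ j) (n : ℕ) (e : ℤ) :
    3 ^ n * mis (w j) (HH j) e ≤ mis (w (j+n)) (HH (j+n)) e := by
  induction n with
  | zero => simp
  | succ k ih =>
    have := mis_triple hw h0 (j := j + k) (by omega) e
    rw [pow_succ, ← add_assoc]
    linarith

theorem mis_lb_mono {w : ℕ → ℤ → Bool} {j0 : ℕ} (hw : Compat w j0) (h0 : 1 ≤ j0)
    {j J : ℕ} (hj : j0 ≤ j) (hJ : j ≤ J) {q : ℝ} {e : ℤ}
    (h : q * 3 ^ j ≤ mis (w j) (HH j) e) : q * 3 ^ J ≤ mis (w J) (HH J) e := by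
  obtain ⟨n, rfl⟩ := Nat.exists_eq_add_of_le hJ
  have := mis_pow hw h0 hj n e
  have h2 : ((3 ^ n * mis (w j) (HH j) e : ℕ) : ℝ) ≤ mis (w (j+n)) (HH (j+n)) e := by
    exact_mod_cast this
  push_cast at h2
  rw [pow_add]
  have : (0:ℝ) < 3 ^ n := by positivity
  nlinarith

theorem mis_diff {w : ℕ → ℤ → Bool} {j0 : ℕ} (hw : Compat w j0) (h0 : 1 ≤ j0)
    {j : ℕ} (hj : j0 ≤ j) (n : ℕ) {e t : ℤ} (ht : 0 ≤ t)
    (he : |e| ≤ HH (j+n) - HH j) :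
    mis (w j) (HH j) t ≤ mis (w (j+n)) (HH (j+n)) e + mis (w (j+n)) (HH (j+n)) (e - t) :=
  mis_shift_diff (occ_pre hw h0 hj n) (occ_suf hw h0 hj n) ht he

/-- the linear trick: shift by `d` of order `HH (j+1)` forces shift by one -/
theorem mis_linear {w : ℕ → ℤ → Bool} {j0 : ℕ} (hw : Compat w j0) (h0 : 1 ≤ j0)
    {j : ℕ} (hj : j0 ≤ j) {d : ℤ}
    (hd : |d - HH (j+1) - (j+1)| ≤ HH (j+1) - HH j) :
    mis (w j) (HH j) 1 ≤ mis (w (j+3)) (HH (j+3)) d := by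
  refine (mis_diff hw h0 hj 1 (t := 1) (by norm_num) hd).trans ?_
  have hs1 := HH_succ (j+1) (by omega)
  have hs2 := HH_succ (j+2) (by omega)
  have hp := HH_pos (j+1)
  have hj1 : j0 ≤ j + 1 := by omega
  have hj2 : j0 ≤ j + 1 + 1 := by omega
  refine mis_two_blocks ((occ2 hw h0 hj1).trans (occ1 hw h0 hj2))
    ((occ3 hw h0 hj1).trans (occ1 hw h0 hj2)) ?_ ((occ3 hw h0 hj1).trans (occ2 hw h0 hj2))
    ((occ1 hw h0 hj1).trans (occ3 hw h0 hj2)) ?_ ?_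
  · push_cast; ring
  · rw [show j + 1 + 1 = j + 2 by ring, show HH (j+2) = _ from hs1]; push_cast; ring
  · rw [show j + 1 + 1 = j + 2 by ring, show HH (j+2) = _ from hs1]; push_cast; omega

theorem comb_pass {w : ℕ → ℤ → Bool} {j0 : ℕ} (hw : Compat w j0) (h0 : 1 ≤ j0)
    {j1 : ℕ} (hj1 : j0 ≤ j1) {q : ℝ} (hq : q * 3 ^ j1 ≤ mis (w j1) (HH j1) 1)
    {d : ℤ} (hd : HH j1 + j1 + 1 ≤ d) {J : ℕ} (hJ : d ≤ HH J) :
    q / 27 * 3 ^ (J + 2) ≤ mis (w (J + 2)) (HH (J + 2)) d := by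
  -- find the scale
  have hex : ∃ j, d < HH (j + 1) + j + 2 := ⟨d.toNat, by
    have := HH_ge (d.toNat + 1); push_cast at this; omega⟩
  classical
  obtain ⟨j, hj, hd1, hd2⟩ : ∃ j, j1 ≤ j ∧ HH j + j + 1 ≤ d ∧ d < HH (j + 1) + j + 2 := by
    refine ⟨Nat.find hex, ?_, ?_, Nat.find_spec hex⟩
    · by_contra hlt
      push Not at hlt
      have h1 := Nat.find_spec hex
      have h2 : HH (Nat.find hex + 1) ≤ HH j1 := HH_strictMono.monotone hlt
      omega
    · rcases Nat.eq_zero_or_pos (Nat.find hex) with h | h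
      · rw [h]
        have := HH_strictMono.monotone (Nat.zero_le j1)
        push_cast; omega
      · have := Nat.find_min hex (Nat.sub_lt h Nat.one_pos)
        rw [Nat.sub_add_cancel h] at this
        omega
  have hjJ : j < J := by
    have : HH j < HH J := by omega
    exact HH_strictMono.lt_iff_lt.1 this
  have hq' : q * 3 ^ j ≤ mis (w j) (HH j) 1 := mis_lb_mono hw h0 hj1 hj hq
  have hm := HH_lt_succ j
  have hl := mis_linear hw h0 (hj1.trans hj) (d := d) (by rw [abs_le]; omega)
  have : q / 27 * 3 ^ (j + 3) ≤ mis (w (j+3)) (HH (j+3)) d := by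
    have : (mis (w j) (HH j) 1 : ℝ) ≤ mis (w (j+3)) (HH (j+3)) d := by exact_mod_cast hl
    rw [pow_add]; linarith
  exact mis_lb_mono hw h0 (by omega) (by omega) this

/-- one-step estimate -/
theorem comb_step {w : ℕ → ℤ → Bool} {j0 : ℕ} (hw : Compat w j0) (h0 : 1 ≤ j0)
    {c : ℝ} (hc : 0 ≤ c) {J1 : ℕ} (hJ1 : j0 ≤ J1)
    (hA : ∀ J, J1 ≤ J → ∀ d : ℤ, 1 ≤ d → d ≤ HH J →
      c * 3 ^ (J+2) ≤ mis (w (J+2)) (HH (J+2)) d)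
    {K : ℕ} (hK : J1 ≤ K) (hK3 : 3 ≤ K) {D : ℤ} (hD1 : 1 ≤ D)
    (hD2 : D < 2 * HH (K + 5) + (K + 5 : ℕ)) :
    c / 27 * 3 ^ (K + 5) ≤ mis (w (K + 6)) (HH (K + 6)) D := by
  have m1 : HH (K+2) < HH (K+3) := HH_lt_succ (K+2)
  have m2 : HH (K+3) < HH (K+4) := HH_lt_succ (K+3)
  have m3 : HH (K+4) < HH (K+5) := HH_lt_succ (K+4)
  have e2 : HH (K+3) = 3 * HH (K+2) + (K+2 : ℕ) := HH_succ (K+2) (by omega)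
  have g := HH_ge5 K hK3
  have g2 := HH_ge5 (K+2) (by omega)
  have p3 : (0:ℝ) < 3 ^ K := by positivity
  by_cases ha : D ≤ HH (K + 4)
  · have := hA (K+4) (by omega) D hD1 ha
    refine le_trans ?_ this
    simp only [pow_add]; norm_num; nlinarith
  push Not at ha
  have hj5 : j0 ≤ K + 5 := by omega
  by_cases hb : D ≤ 2 * HH (K+5) - HH (K+2)
  · have h1 := mis_diff hw h0 (j := K+2) (by omega) 3 (e := D - HH (K+5)) (t := (K + 5 : ℕ))
      (by omega) (by rw [abs_le, show K + 2 + 3 = K + 5 by ring]; constructor <;> omega)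
    have h2 : mis (w (K+5)) (HH (K+5)) (D - HH (K+5)) +
        mis (w (K+5)) (HH (K+5)) (D - HH (K+5) - (K+5 : ℕ)) ≤ mis (w (K+6)) (HH (K+6)) D :=
      mis_two_blocks (occ1 hw h0 hj5) (occ2 hw h0 hj5) (by ring) (occ2 hw h0 hj5)
        (occ3 hw h0 hj5) (by ring) (by omega)
    have h3 := hA K hK (K + 5 : ℕ) (by push_cast; omega) (by push_cast; omega)
    have h4 : (mis (w (K+2)) (HH (K+2)) (K+5 : ℕ) : ℝ) ≤ mis (w (K+6)) (HH (K+6)) D := by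
      exact_mod_cast h1.trans h2
    refine le_trans ?_ (h3.trans h4)
    simp only [pow_add]; norm_num; nlinarith
  · push Not at hb
    have h1 : mis (w (K+5)) (HH (K+5)) (D - 2 * HH (K+5) - (K+5 : ℕ)) ≤
        mis (w (K+6)) (HH (K+6)) D :=
      mis_one_block (occ1 hw h0 hj5) (occ3 hw h0 hj5) (by ring)
    rw [← mis_neg] at h1
    have h3 := hA (K+3) (by omega) (-(D - 2 * HH (K+5) - (K+5 : ℕ))) (by omega)
      (by push_cast at hb g2 e2 ⊢; omega)
    have h4 : (mis (w (K+5)) (HH (K+5)) (-(D - 2 * HH (K+5) - (K+5 : ℕ))) : ℝ) ≤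
      mis (w (K+6)) (HH (K+6)) D := by exact_mod_cast h1
    refine le_trans ?_ (h3.trans h4)
    simp only [pow_add]; norm_num; nlinarith

theorem comb_main {w : ℕ → ℤ → Bool} {j0 : ℕ} (hw : Compat w j0) (h0 : 1 ≤ j0)
    {c : ℝ} (hc : 0 ≤ c) {J1 : ℕ} (hJ1 : j0 ≤ J1)
    (hA : ∀ J, J1 ≤ J → ∀ d : ℤ, 1 ≤ d → d ≤ HH J →
      c * 3 ^ (J+2) ≤ mis (w (J+2)) (HH (J+2)) d)
    {j : ℕ} (hj : J1 + 8 ≤ j) {w' : ℕ → ℤ → Bool} (hw' : Compat w' j) (n : ℕ) :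
    ∀ D : ℤ, 0 ≤ D → D ≤ HH (j + n) - HH j →
      c / 27 * 3 ^ j ≤ mis (w (j+n)) (HH (j+n)) D ∨ mis (w' (j+n)) (HH (j+n)) D = 0 := by
  induction n with
  | zero =>
    intro D h1 h2
    simp only [add_zero, sub_self] at h2
    obtain rfl : D = 0 := by omega
    right; exact mis_zero _ _
  | succ n ih =>
    intro D h1 h2
    have hs := HH_succ (j+n) (by omega)
    rw [← add_assoc] at h2 ⊢
    rcases eq_or_lt_of_le h1 with rfl | hpos
    · right; exact mis_zero _ _
    by_cases hD : D < 2 * HH (j+n) + (j+n : ℕ)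
    · left
      obtain ⟨K, hK⟩ : ∃ K, j + n = K + 5 := ⟨j + n - 5, by omega⟩
      rw [hK] at hD ⊢
      have := comb_step hw h0 hc hJ1 hA (K := K) (by omega) (by omega) (D := D) (by omega) hD
      refine le_trans ?_ this
      gcongr
      · norm_num
      · omega
    · push Not at hD
      have h3 : mis (w (j+n)) (HH (j+n)) (D - (2 * HH (j+n) + (j+n : ℕ))) ≤
          mis (w (j+n+1)) (HH (j+n+1)) D :=
        mis_one_block (occ1 hw h0 (by omega)) (occ3 hw h0 (by omega)) (by ring)
      rcases ih (D - (2 * HH (j+n) + (j+n : ℕ))) (by omega) (by omega) with h | h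
      · left
        exact h.trans (by exact_mod_cast h3)
      · right
        unfold mis at h ⊢
        rw [Finset.card_eq_zero, Finset.eq_empty_iff_forall_notMem] at h ⊢
        intro i hi
        apply h i
        rw [mem_misSet] at hi ⊢
        obtain ⟨i0, iH, i1, i2, i3⟩ := hi
        have hp := HH_pos (j+n)
        have e1 := (hw' (j+n) (by omega) i i0 (by omega)).1
        have e2 := (hw' (j+n) (by omega) (i + (D - (2 * HH (j+n) + (j+n : ℕ))))
          (by omega) (by omega)).2.2
        have r : i + (D - (2 * HH (j+n) + (j+n : ℕ))) + (2 * HH (j+n) + (j+n : ℕ)) = i + D := by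
          ring
        rw [r] at e2
        rw [e1, e2] at i3
        exact ⟨i0, by omega, by omega, by omega, i3⟩

end

section towers
set_option linter.unusedSectionVars false
variable {X : Type*} [m : MeasurableSpace X] {μ : Measure X} [IsProbabilityMeasure μ]

theorem HH_eq (C : ChaconMap μ (fun j => j)) (j : ℕ) (hj : 1 ≤ j) : (C.h j : ℤ) + 1 = HH j := by
  induction j, hj using Nat.le_induction with
  | base => simp [HH, C.h_one]
  | succ k hk ih => rw [HH_succ k hk, C.h_succ k hk, ← ih]; push_cast; ring

theorem image_iter (C : ChaconMap μ (fun j => j)) (i : ℕ) (S : Set X) :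
    (⇑C.T)^[i] '' S = (⇑C.T.symm)^[i] ⁻¹' S := by
  have h1 : Function.LeftInverse (⇑C.T.symm)^[i] (⇑C.T)^[i] :=
    Function.LeftInverse.iterate C.T.symm_apply_apply i
  have h2 : Function.RightInverse (⇑C.T.symm)^[i] (⇑C.T)^[i] :=
    Function.LeftInverse.iterate C.T.apply_symm_apply i
  exact congrFun (Set.image_eq_preimage_of_inverse h1 h2) S

theorem mp_symm (C : ChaconMap μ (fun j => j)) (i : ℕ) :
    MeasurePreserving (⇑C.T.symm)^[i] μ μ :=
  (MeasurePreserving.symm C.T C.measurePreserving).iterate i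

theorem mp_iter (C : ChaconMap μ (fun j => j)) (i : ℕ) :
    MeasurePreserving (⇑C.T)^[i] μ μ := C.measurePreserving.iterate i

/-- The level `i` of tower `j`. -/
def Lv (C : ChaconMap μ (fun j => j)) (j : ℕ) (i : ℤ) : Set X := (⇑C.T)^[i.toNat] '' C.E j

theorem Lv_eq (C : ChaconMap μ (fun j => j)) (j : ℕ) (i : ℤ) :
    Lv C j i = (⇑C.T.symm)^[i.toNat] ⁻¹' C.E j := image_iter C _ _

theorem measurableSet_Lv (C : ChaconMap μ (fun j => j)) (j : ℕ) (i : ℤ) :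
    MeasurableSet (Lv C j i) := by
  rw [Lv_eq]; exact (mp_symm C _).measurable (C.measE j)

theorem measure_Lv (C : ChaconMap μ (fun j => j)) (j : ℕ) (i : ℤ) :
    μ (Lv C j i) = μ (C.E j) := by
  rw [Lv_eq]; exact (mp_symm C _).measure_preimage (C.measE j).nullMeasurableSet

theorem real_Lv (C : ChaconMap μ (fun j => j)) (j : ℕ) (i : ℤ) :
    μ.real (Lv C j i) = μ.real (C.E j) := by
  simp [Measure.real, measure_Lv]

theorem disjoint_Lv (C : ChaconMap μ (fun j => j)) {j : ℕ} (hj : 1 ≤ j) {i i' : ℤ} (hi : 0 ≤ i)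
    (hiH : i < HH j) (hi' : 0 ≤ i') (hiH' : i' < HH j) (hne : i ≠ i') :
    Disjoint (Lv C j i) (Lv C j i') := by
  have := HH_eq C j hj
  exact C.tower_disjoint j hj _ (by omega) _ (by omega) (by omega)

theorem iter_mem_Lv (C : ChaconMap μ (fun j => j)) {j : ℕ} {i : ℤ} (hi : 0 ≤ i) (d : ℕ) {x : X} :
    (⇑C.T)^[d] x ∈ Lv C j (i + d) ↔ x ∈ Lv C j i := by
  unfold Lv
  have : (i + d).toNat = d + i.toNat := by omega
  rw [this, Function.iterate_add, Set.image_comp]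
  exact (C.T.injective.iterate d).mem_set_image

theorem ae_eq_image (C : ChaconMap μ (fun j => j)) (i : ℕ) {S S' : Set X} (h : S =ᵐ[μ] S') :
    ((⇑C.T)^[i] '' S : Set X) =ᵐ[μ] ((⇑C.T)^[i] '' S' : Set X) := by
  rw [image_iter, image_iter]
  exact (mp_symm C i).quasiMeasurePreserving.preimage_ae_eq h

theorem Lv_succ (C : ChaconMap μ (fun j => j)) {j : ℕ} (hj : 1 ≤ j) {i : ℤ} (hi : 0 ≤ i) :
    (Lv C j i : Set X) =ᵐ[μ] (Lv C (j+1) i ∪ Lv C (j+1) (i + HH j) ∪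
      Lv C (j+1) (i + (2 * HH j + j)) : Set X) := by
  have hH := HH_eq C j hj
  have s1 := measure_symmDiff_eq_zero_iff.1 (C.stack1 j hj)
  have s2 := measure_symmDiff_eq_zero_iff.1 (C.stack2 j hj)
  have s3 : C.E3 j =ᵐ[μ] ((⇑C.T)^[C.h j + 1 + j + (C.h j + 1)] '' C.E1 j : Set X) := by
    refine s2.symm.trans ?_
    refine (ae_eq_image C _ s1.symm).trans ?_
    rw [← Set.image_comp, ← Function.iterate_add]
    exact ae_eq_refl _
  have key : C.E j =ᵐ[μ] (C.E1 j ∪ (⇑C.T)^[C.h j + 1] '' C.E1 j ∪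
      (⇑C.T)^[C.h j + 1 + j + (C.h j + 1)] '' C.E1 j : Set X) := by
    rw [C.E_union j hj]
    exact ((ae_eq_refl _).union s1.symm).union s3
  have := ae_eq_image C i.toNat key
  unfold Lv
  refine this.trans (Eq.eventuallyEq ?_)
  rw [Set.image_union, Set.image_union, C.E_next j hj, ← Set.image_comp, ← Set.image_comp,
    ← Function.iterate_add, ← Function.iterate_add]
  congr 4
  · omega
  · omega

theorem measure_E_succ (C : ChaconMap μ (fun j => j)) {j : ℕ} (hj : 1 ≤ j) :
    μ.real (C.E j) = 3 * μ.real (C.E (j+1)) := by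
  rw [C.E_next j hj]
  have h12 := C.E_meas12 j hj
  have h23 := C.E_meas23 j hj
  rw [C.E_union j hj, measureReal_union _ (C.measE3 j), measureReal_union (C.E_disj12 j hj) (C.measE2 j)]
  · simp only [Measure.real, ← h23, ← h12]; ring
  · exact Disjoint.union_left (C.E_disj13 j hj) (C.E_disj23 j hj)

/-- scaling constant -/
theorem measure_E_pow (C : ChaconMap μ (fun j => j)) {j : ℕ} (hj : 1 ≤ j) :
    μ.real (C.E j) * 3 ^ j = 3 * μ.real (C.E 1) := by
  induction j, hj using Nat.le_induction with
  | base => ring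
  | succ k hk ih => rw [← ih, measure_E_succ C hk]; ring

/-- union of levels given by a word -/
def Bset (C : ChaconMap μ (fun j => j)) (j : ℕ) (v : ℤ → Bool) : Set X :=
  ⋃ i ∈ (Finset.Ico 0 (HH j)).filter (fun i => v i = true), Lv C j i

theorem mem_Bset (C : ChaconMap μ (fun j => j)) {j : ℕ} {v : ℤ → Bool} {x : X} :
    x ∈ Bset C j v ↔ ∃ i, 0 ≤ i ∧ i < HH j ∧ v i = true ∧ x ∈ Lv C j i := by
  simp [Bset, and_assoc]

theorem measurableSet_Bset (C : ChaconMap μ (fun j => j)) (j : ℕ) (v : ℤ → Bool) :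
    MeasurableSet (Bset C j v) :=
  Finset.measurableSet_biUnion _ (fun i _ => measurableSet_Lv C j i)

theorem mem_Bset_of_Lv (C : ChaconMap μ (fun j => j)) {j : ℕ} (hj : 1 ≤ j) {v : ℤ → Bool} {x : X}
    {i : ℤ} (hi : 0 ≤ i) (hiH : i < HH j) (hx : x ∈ Lv C j i) :
    x ∈ Bset C j v ↔ v i = true := by
  rw [mem_Bset]
  constructor
  · rintro ⟨i', h1, h2, h3, h4⟩
    by_cases hne : i = i'
    · rw [hne]; exact h3
    · exact absurd h4 (Set.disjoint_left.1 (disjoint_Lv C hj hi hiH h1 h2 hne) hx)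
  · intro h
    exact ⟨i, hi, hiH, h, hx⟩

theorem measure_biUnion_Lv (C : ChaconMap μ (fun j => j)) {j : ℕ} (hj : 1 ≤ j) (S : Finset ℤ)
    (hS : ∀ i ∈ S, 0 ≤ i ∧ i < HH j) : μ.real (⋃ i ∈ S, Lv C j i) = S.card * μ.real (C.E j) := by
  rw [measureReal_biUnion_finset]
  · simp [real_Lv]
  · intro i hi i' hi' hne
    exact disjoint_Lv C hj (hS i hi).1 (hS i hi).2 (hS i' hi').1 (hS i' hi').2 hne
  · intro i _; exact measurableSet_Lv C j i

/-- The whole tower. -/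
def tow (C : ChaconMap μ (fun j => j)) (j : ℕ) : Set X := ⋃ i ∈ Finset.Ico 0 (HH j), Lv C j i

theorem measurableSet_tow (C : ChaconMap μ (fun j => j)) (j : ℕ) : MeasurableSet (tow C j) :=
  Finset.measurableSet_biUnion _ (fun i _ => measurableSet_Lv C j i)

theorem mem_tow (C : ChaconMap μ (fun j => j)) {j : ℕ} {x : X} :
    x ∈ tow C j ↔ ∃ i, 0 ≤ i ∧ i < HH j ∧ x ∈ Lv C j i := by
  simp [tow, and_assoc]

theorem real_tow (C : ChaconMap μ (fun j => j)) {j : ℕ} (hj : 1 ≤ j) :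
    μ.real (tow C j) = HH j * μ.real (C.E j) := by
  unfold tow
  rw [measure_biUnion_Lv C hj _ (fun i hi => Finset.mem_Ico.1 hi), Int.card_Ico]
  have := HH_pos j
  congr 1
  have h : ((HH j - 0).toNat : ℤ) = HH j := by omega
  exact_mod_cast h

theorem tendsto_tow (C : ChaconMap μ (fun j => j)) :
    Tendsto (fun j => μ.real (tow C j)) atTop (𝓝 1) := by
  have h := (ENNReal.tendsto_toReal (a := 1) (by simp)).comp C.tower_full
  simp only [ENNReal.toReal_one] at h
  refine h.congr' ?_
  filter_upwards [eventually_ge_atTop 1] with j hj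
  simp only [Function.comp, Measure.real]
  congr 2
  ext x
  rw [mem_tow]
  have := HH_eq C j hj
  simp only [Finset.mem_range, Set.mem_iUnion, exists_prop]
  constructor
  · rintro ⟨i, hi, hx⟩
    exact ⟨i, by omega, by omega, by simpa [Lv] using hx⟩
  · rintro ⟨i, hi, hi', hx⟩
    exact ⟨i.toNat, by omega, hx⟩

theorem tendsto_compl (C : ChaconMap μ (fun j => j)) :
    Tendsto (fun j => μ.real (tow C j)ᶜ) atTop (𝓝 0) := by
  have h : Tendsto (fun j => 1 - μ.real (tow C j)) atTop (𝓝 (1 - 1)) :=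
    tendsto_const_nhds.sub (tendsto_tow C)
  rw [sub_self] at h
  refine h.congr (fun j => ?_)
  rw [probReal_compl_eq_one_sub (measurableSet_tow C j)]

theorem kappa_pos (C : ChaconMap μ (fun j => j)) : 0 < μ.real (C.E 1) := by
  by_contra h
  have h0 : μ.real (C.E 1) = 0 := le_antisymm (not_lt.1 h) measureReal_nonneg
  have : Tendsto (fun j => μ.real (tow C j)) atTop (𝓝 0) := by
    refine tendsto_const_nhds.congr' ?_
    filter_upwards [eventually_ge_atTop 1] with j hj
    have h1 := measure_E_pow C hj
    rw [h0, mul_zero] at h1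
    have : μ.real (C.E j) = 0 := by
      rcases mul_eq_zero.1 h1 with h | h
      · exact h
      · exact absurd h (by positivity)
    rw [real_tow C hj, this, mul_zero]
  exact zero_ne_one (tendsto_nhds_unique this (tendsto_tow C))

theorem tendsto_E (C : ChaconMap μ (fun j => j)) :
    Tendsto (fun j => μ.real (C.E j)) atTop (𝓝 0) := by
  have h : Tendsto (fun j : ℕ => 3 * μ.real (C.E 1) * (1/3 : ℝ) ^ j) atTop (𝓝 0) := by
    have := (tendsto_pow_atTop_nhds_zero_of_lt_one (r := (1/3 : ℝ)) (by norm_num)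
      (by norm_num)).const_mul (3 * μ.real (C.E 1))
    simpa using this
  refine h.congr' ?_
  filter_upwards [eventually_ge_atTop 1] with j hj
  rw [← measure_E_pow C hj, mul_assoc, ← mul_pow]; norm_num

/-- extension of a word at stage `j0` to later stages -/
def wx (v : ℤ → Bool) (j0 : ℕ) : ℕ → ℤ → Bool
  | 0 => v
  | (j + 1) => if j + 1 ≤ j0 then v else fun i =>
      if i < HH j then wx v j0 j i else if i < 2 * HH j then wx v j0 j (i - HH j) else
      if i < 2 * HH j + j then false else wx v j0 j (i - (2 * HH j + j))

theorem wx_le (v : ℤ → Bool) (j0 : ℕ) {j : ℕ} (h : j ≤ j0) : wx v j0 j = v := by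
  cases j with
  | zero => rfl
  | succ k => simp [wx, h]

theorem wx_succ (v : ℤ → Bool) (j0 : ℕ) {j : ℕ} (h : j0 ≤ j) : wx v j0 (j+1) = fun i =>
      if i < HH j then wx v j0 j i else if i < 2 * HH j then wx v j0 j (i - HH j) else
      if i < 2 * HH j + j then false else wx v j0 j (i - (2 * HH j + j)) := by
  simp [wx, show ¬ (j + 1 ≤ j0) by omega]

theorem wx_compat (v : ℤ → Bool) (j0 : ℕ) : Compat (wx v j0) j0 := by
  intro j hj i hi hiH
  rw [wx_succ v j0 hj]
  have := HH_pos j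
  refine ⟨?_, ?_, ?_⟩
  · simp [hiH]
  · simp [show ¬ (i + HH j < HH j) by omega, show i + HH j < 2 * HH j by omega]
  · simp [show ¬ (i + (2 * HH j + j) < HH j) by omega, show ¬ (i + (2 * HH j + j) < 2 * HH j) by omega,
      hi]

theorem Bset_succ (C : ChaconMap μ (fun j => j)) (v : ℤ → Bool) {j0 j : ℕ} (h0 : 1 ≤ j0)
    (hj : j0 ≤ j) : (Bset C j (wx v j0 j) : Set X) =ᵐ[μ] Bset C (j+1) (wx v j0 (j+1)) := by
  have h1 : (Bset C j (wx v j0 j) : Set X) =ᵐ[μ]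
      (⋃ i ∈ (Finset.Ico 0 (HH j)).filter (fun i => wx v j0 j i = true), (Lv C (j+1) i ∪
        Lv C (j+1) (i + HH j) ∪ Lv C (j+1) (i + (2 * HH j + j))) : Set X) := by
    unfold Bset
    refine Filter.EventuallyEq.countable_bUnion (Finset.countable_toSet _) ?_
    intro i hi
    exact Lv_succ C (by omega) (Finset.mem_Ico.1 (Finset.mem_filter.1 hi).1).1
  refine h1.trans (Filter.EventuallyEq.of_eq ?_)
  have hs := HH_succ j (by omega)
  have hp := HH_pos j
  have hc := wx_compat v j0 j hj
  refine Set.ext fun x => ?_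
  rw [mem_Bset]
  simp only [Finset.mem_filter, Finset.mem_Ico, Set.mem_iUnion, exists_prop, Set.mem_union]
  constructor
  · rintro ⟨i, ⟨⟨hi, hiH⟩, hv⟩, (hx | hx) | hx⟩
    · exact ⟨i, hi, by omega, (hc i hi hiH).1.trans hv, hx⟩
    · exact ⟨_, by omega, by omega, (hc i hi hiH).2.1.trans hv, hx⟩
    · exact ⟨_, by omega, by omega, (hc i hi hiH).2.2.trans hv, hx⟩
  · rintro ⟨i, hi, hiH, hv, hx⟩
    rw [wx_succ v j0 hj] at hv
    simp only at hv
    split_ifs at hv with g1 g2 g3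
    · exact ⟨i, ⟨⟨hi, g1⟩, hv⟩, Or.inl (Or.inl hx)⟩
    · refine ⟨i - HH j, ⟨⟨by omega, by omega⟩, hv⟩, Or.inl (Or.inr ?_)⟩
      rwa [sub_add_cancel]
    · refine ⟨i - (2 * HH j + j), ⟨⟨by omega, by omega⟩, hv⟩, Or.inr ?_⟩
      rwa [sub_add_cancel]

/-- `B` is described by the family of words `w` from stage `j0` on. -/
def Desc (C : ChaconMap μ (fun j => j)) (B : Set X) (w : ℕ → ℤ → Bool) (j0 : ℕ) : Prop :=
  1 ≤ j0 ∧ Compat w j0 ∧ MeasurableSet B ∧ ∀ j, j0 ≤ j → B =ᵐ[μ] Bset C j (w j)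

theorem desc_Bset (C : ChaconMap μ (fun j => j)) (v : ℤ → Bool) {j0 : ℕ} (h0 : 1 ≤ j0) :
    Desc C (Bset C j0 v) (wx v j0) j0 := by
  refine ⟨h0, wx_compat v j0, measurableSet_Bset C _ _, fun j hj => ?_⟩
  induction j, hj using Nat.le_induction with
  | base => rw [wx_le v j0 le_rfl]; exact ae_eq_refl _
  | succ k hk ih => exact ih.trans (Bset_succ C v h0 hk)

/-- shift discrepancy -/
noncomputable def rho (C : ChaconMap μ (fun j => j)) (B : Set X) (d : ℕ) : ℝ :=
  μ.real (B ∆ ((⇑C.T)^[d] ⁻¹' B))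

theorem rho_congr (C : ChaconMap μ (fun j => j)) {B B' : Set X} (h : B =ᵐ[μ] B') (d : ℕ) :
    rho C B d = rho C B' d :=
  measureReal_congr (h.symmDiff ((mp_iter C d).quasiMeasurePreserving.preimage_ae_eq h))

theorem mis_le_rho_aux (C : ChaconMap μ (fun j => j)) {j : ℕ} (hj : 1 ≤ j) (v : ℤ → Bool) (d : ℕ) :
    mis v (HH j) d * μ.real (C.E j) ≤ rho C (Bset C j v) d := by
  rw [mis, ← measure_biUnion_Lv C hj _ (fun i hi => by rw [mem_misSet] at hi; exact ⟨hi.1, hi.2.1⟩)]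
  refine measureReal_mono ?_
  intro x hx
  simp only [Set.mem_iUnion, exists_prop] at hx
  obtain ⟨i, hi, hx⟩ := hx
  rw [mem_misSet] at hi
  obtain ⟨h1, h2, h3, h4, h5⟩ := hi
  have e1 := mem_Bset_of_Lv C hj (v := v) h1 h2 hx
  have e2 := mem_Bset_of_Lv C hj (v := v) h3 h4 ((iter_mem_Lv C h1 d).2 hx)
  rw [Set.mem_symmDiff, Set.mem_preimage, e1, e2]
  cases h : v i <;> cases h' : v (i + d) <;> simp_all

theorem rho_le_mis_aux (C : ChaconMap μ (fun j => j)) {j : ℕ} (hj : 1 ≤ j) (v : ℤ → Bool) (d : ℕ) :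
    rho C (Bset C j v) d ≤ (mis v (HH j) d + d) * μ.real (C.E j) + μ.real (tow C j)ᶜ := by
  have hsub : (Bset C j v) ∆ ((⇑C.T)^[d] ⁻¹' (Bset C j v)) ⊆
      ((⋃ i ∈ misSet v (HH j) d, Lv C j i) ∪
        ⋃ i ∈ (Finset.Ico 0 (HH j)).filter (fun i => HH j - d ≤ i), Lv C j i) ∪ (tow C j)ᶜ := by
    intro x hx
    by_cases ht : x ∈ tow C j
    · left
      obtain ⟨i, h1, h2, hxi⟩ := (mem_tow C).1 ht
      by_cases hid : HH j - d ≤ i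
      · right
        simp only [Set.mem_iUnion, exists_prop]
        exact ⟨i, Finset.mem_filter.2 ⟨Finset.mem_Ico.2 ⟨h1, h2⟩, hid⟩, hxi⟩
      · left
        simp only [Set.mem_iUnion, exists_prop]
        refine ⟨i, ?_, hxi⟩
        rw [mem_misSet]
        have e1 := mem_Bset_of_Lv C hj (v := v) h1 h2 hxi
        have e2 := mem_Bset_of_Lv C hj (v := v) (by omega) (by omega) ((iter_mem_Lv C h1 d).2 hxi)
        rw [Set.mem_symmDiff, Set.mem_preimage, e1, e2] at hx
        refine ⟨h1, h2, by omega, by omega, ?_⟩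
        cases h : v i <;> cases h' : v (i + d) <;> simp_all
    · right; exact ht
  refine (measureReal_mono hsub).trans ((measureReal_union_le _ _).trans ?_)
  gcongr
  refine (measureReal_union_le _ _).trans ?_
  rw [measure_biUnion_Lv C hj _ (fun i hi => by rw [mem_misSet] at hi; exact ⟨hi.1, hi.2.1⟩),
    measure_biUnion_Lv C hj _ (fun i hi => Finset.mem_Ico.1 (Finset.mem_filter.1 hi).1), ← add_mul]
  gcongr
  · exact le_rfl
  have : ((Finset.Ico 0 (HH j)).filter (fun i => HH j - d ≤ i)) ⊆ Finset.Ico (HH j - d) (HH j) := by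
    intro i hi
    simp at hi ⊢; omega
  have := Finset.card_le_card this
  rw [Int.card_Ico] at this
  omega

theorem mis_le_rho (C : ChaconMap μ (fun j => j)) {B : Set X} {w : ℕ → ℤ → Bool} {j0 : ℕ}
    (h : Desc C B w j0) {j : ℕ} (hj : j0 ≤ j) (d : ℕ) :
    mis (w j) (HH j) d * μ.real (C.E j) ≤ rho C B d := by
  rw [rho_congr C (h.2.2.2 j hj)]
  exact mis_le_rho_aux C (h.1.trans hj) _ _

/-- eventually the mismatch density approximates `rho` -/
theorem exists_mis_ge (C : ChaconMap μ (fun j => j)) {B : Set X} {w : ℕ → ℤ → Bool} {j0 : ℕ}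
    (h : Desc C B w j0) (d : ℕ) {q : ℝ} (hq : q < rho C B d) :
    ∃ J, j0 ≤ J ∧ q ≤ mis (w J) (HH J) d * μ.real (C.E J) := by
  have h1 : Tendsto (fun j => d * μ.real (C.E j) + μ.real (tow C j)ᶜ) atTop (𝓝 0) := by
    simpa using ((tendsto_E C).const_mul (d : ℝ)).add (tendsto_compl C)
  have h2 := h1.eventually (gt_mem_nhds (sub_pos.2 hq))
  obtain ⟨J, hJ, hJ0⟩ := (h2.and (eventually_ge_atTop j0)).exists
  refine ⟨J, hJ0, ?_⟩
  have := rho_le_mis_aux C (h.1.trans hJ0) (w J) d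
  rw [← rho_congr C (h.2.2.2 J hJ0)] at this
  nlinarith

theorem rho_approx (C : ChaconMap μ (fun j => j)) {A B : Set X} (hA : MeasurableSet A)
    (hB : MeasurableSet B) (d : ℕ) : rho C A d ≤ rho C B d + 2 * μ.real (A ∆ B) := by
  have hsub : A ∆ ((⇑C.T)^[d] ⁻¹' A) ⊆ (B ∆ ((⇑C.T)^[d] ⁻¹' B)) ∪ (A ∆ B) ∪
      (⇑C.T)^[d] ⁻¹' (A ∆ B) := by
    intro x
    simp only [Set.mem_symmDiff, Set.mem_union, Set.mem_preimage]
    tauto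
  have h1 := (measureReal_mono (μ := μ) hsub).trans ((measureReal_union_le _ _).trans
    (add_le_add_left (measureReal_union_le _ _) _))
  have h2 : μ.real ((⇑C.T)^[d] ⁻¹' (A ∆ B)) = μ.real (A ∆ B) := by
    simp only [Measure.real]
    rw [(mp_iter C d).measure_preimage (hA.symmDiff hB).nullMeasurableSet]
  unfold rho
  linarith

end towers

section approx
set_option linter.unusedSectionVars false
variable {X : Type*} [m : MeasurableSpace X] {μ : Measure X} [IsProbabilityMeasure μ]

/-- approximability by unions of levels -/
def Apx (C : ChaconMap μ (fun j => j)) (A : Set X) : Prop :=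
  ∀ ε : ℝ, 0 < ε → ∃ j0, 1 ≤ j0 ∧ ∀ j, j0 ≤ j → ∃ v, μ.real (A ∆ Bset C j v) < ε

theorem apx_congr (C : ChaconMap μ (fun j => j)) {A B : Set X} (h : A =ᵐ[μ] B) (hB : Apx C B) :
    Apx C A := by
  intro ε hε
  obtain ⟨j0, h0, hj⟩ := hB ε hε
  refine ⟨j0, h0, fun j hj0 => ?_⟩
  obtain ⟨v, hv⟩ := hj j hj0
  refine ⟨v, ?_⟩
  have e : μ.real (A ∆ Bset C j v) = μ.real (B ∆ Bset C j v) :=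
    measureReal_congr (h.symmDiff (ae_eq_refl _))
  rw [e]; exact hv

theorem apx_Lv (C : ChaconMap μ (fun j => j)) {j : ℕ} (hj : 1 ≤ j) {i : ℤ} (hi : 0 ≤ i)
    (hiH : i < HH j) : Apx C (Lv C j i) := by
  intro ε hε
  have hd := desc_Bset C (fun k => decide (k = i)) hj
  have he : Bset C j (fun k => decide (k = i)) = Lv C j i := by
    refine Set.ext fun x => ?_
    rw [mem_Bset]
    constructor
    · rintro ⟨k, _, _, hk, hx⟩
      rw [decide_eq_true_eq] at hk
      rwa [hk] at hx
    · intro hx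
      exact ⟨i, hi, hiH, by simp, hx⟩
  rw [he] at hd
  refine ⟨j, hj, fun J hJ => ⟨wx (fun k => decide (k = i)) j J, ?_⟩⟩
  have := measure_symmDiff_eq_zero_iff.2 (hd.2.2.2 J hJ)
  rw [Measure.real, this]; simpa using hε

theorem apx_empty (C : ChaconMap μ (fun j => j)) : Apx C ∅ := by
  intro ε hε
  refine ⟨1, le_rfl, fun j _ => ⟨fun _ => false, ?_⟩⟩
  have : Bset C j (fun _ => false) = ∅ := by
    refine Set.ext fun x => ?_
    rw [mem_Bset]; simp
  rw [this]; simpa using hε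

theorem apx_compl (C : ChaconMap μ (fun j => j)) {A : Set X} (hA : Apx C A) : Apx C Aᶜ := by
  intro ε hε
  obtain ⟨j0, h0, hj⟩ := hA (ε/2) (by positivity)
  obtain ⟨j1, hj1⟩ := eventually_atTop.1 ((tendsto_compl C).eventually
    (gt_mem_nhds (show (0:ℝ) < ε/2 by positivity)))
  refine ⟨max j0 j1, by omega, fun j hjm => ?_⟩
  obtain ⟨v, hv⟩ := hj j (by omega)
  have h2 := hj1 j (by omega)
  refine ⟨fun i => !(v i), ?_⟩
  have hsub : Aᶜ ∆ Bset C j (fun i => !(v i)) ⊆ (A ∆ Bset C j v) ∪ (tow C j)ᶜ := by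
    intro x hx
    by_cases ht : x ∈ tow C j
    · left
      obtain ⟨i, h1, h2, hxi⟩ := (mem_tow C).1 ht
      have e1 := mem_Bset_of_Lv C (by omega) (v := v) h1 h2 hxi
      have e2 := mem_Bset_of_Lv C (by omega) (v := fun i => !(v i)) h1 h2 hxi
      rw [Set.mem_symmDiff, e2] at hx
      rw [Set.mem_symmDiff, e1]
      cases h : v i <;> simp_all
    · right; exact ht
  have := (measureReal_mono (μ := μ) hsub).trans (measureReal_union_le _ _)
  linarith

theorem apx_union (C : ChaconMap μ (fun j => j)) {A B : Set X} (hA : Apx C A) (hB : Apx C B) :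
    Apx C (A ∪ B) := by
  intro ε hε
  obtain ⟨j0, h0, hj⟩ := hA (ε/2) (by positivity)
  obtain ⟨j1, h1, hj1⟩ := hB (ε/2) (by positivity)
  refine ⟨max j0 j1, by omega, fun j hjm => ?_⟩
  obtain ⟨v, hv⟩ := hj j (by omega)
  obtain ⟨v', hv'⟩ := hj1 j (by omega)
  refine ⟨fun i => v i || v' i, ?_⟩
  have he : Bset C j (fun i => v i || v' i) = Bset C j v ∪ Bset C j v' := by
    refine Set.ext fun x => ?_
    simp only [Set.mem_union, mem_Bset, Bool.or_eq_true]
    constructor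
    · rintro ⟨i, a, b, c | c, d⟩
      · left; exact ⟨i, a, b, c, d⟩
      · right; exact ⟨i, a, b, c, d⟩
    · rintro (⟨i, a, b, c, d⟩ | ⟨i, a, b, c, d⟩)
      · exact ⟨i, a, b, Or.inl c, d⟩
      · exact ⟨i, a, b, Or.inr c, d⟩
  have hsub : (A ∪ B) ∆ Bset C j (fun i => v i || v' i) ⊆
      (A ∆ Bset C j v) ∪ (B ∆ Bset C j v') := by
    rw [he]
    intro x
    simp only [Set.mem_symmDiff, Set.mem_union]
    tauto
  have := (measureReal_mono (μ := μ) hsub).trans (measureReal_union_le _ _)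
  linarith

theorem apx_iUnion (C : ChaconMap μ (fun j => j)) {f : ℕ → Set X} (hm : ∀ n, MeasurableSet (f n))
    (hf : ∀ n, Apx C (f n)) : Apx C (⋃ n, f n) := by
  intro ε hε
  have hacc : ∀ n, Apx C (Set.accumulate f n) := by
    intro n
    induction n with
    | zero => simpa using hf 0
    | succ k ih => rw [Set.accumulate_succ]; exact apx_union C ih (hf _)
  have hmacc : ∀ n, MeasurableSet (Set.accumulate f n) := fun n => by
    unfold Set.accumulate
    exact MeasurableSet.iUnion fun k => MeasurableSet.iUnion fun _ => hm k
  have ht : Tendsto (fun n => μ.real (Set.accumulate f n)) atTop (𝓝 (μ.real (⋃ n, f n))) :=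
    (ENNReal.tendsto_toReal (measure_ne_top _ _)).comp tendsto_measure_iUnion_accumulate
  obtain ⟨n, hn⟩ := (ht.eventually (lt_mem_nhds
    (show μ.real (⋃ n, f n) - ε/2 < μ.real (⋃ n, f n) by linarith))).exists
  obtain ⟨j0, h0, hj⟩ := hacc n (ε/2) (by positivity)
  refine ⟨j0, h0, fun j hj0 => ?_⟩
  obtain ⟨v, hv⟩ := hj j hj0
  refine ⟨v, ?_⟩
  have hs : Set.accumulate f n ⊆ ⋃ n, f n := Set.accumulate_subset_iUnion n
  have hsub : (⋃ n, f n) ∆ Bset C j v ⊆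
      ((⋃ n, f n) \ Set.accumulate f n) ∪ (Set.accumulate f n ∆ Bset C j v) := by
    intro x
    have := @hs x
    simp only [Set.mem_symmDiff, Set.mem_union, Set.mem_sdiff]
    tauto
  have h1 := (measureReal_mono (μ := μ) hsub).trans (measureReal_union_le _ _)
  have h2 := measureReal_sdiff_add_inter (μ := μ) (s := ⋃ n, f n) (hmacc n)
  rw [Set.inter_eq_self_of_subset_right hs] at h2
  linarith

theorem apx_all (C : ChaconMap μ (fun j => j)) {A : Set X} (hA : MeasurableSet A) : Apx C A := by
  obtain ⟨B, hB, hAB⟩ := C.generates A hA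
  refine apx_congr C (measure_symmDiff_eq_zero_iff.1 hAB) ?_
  have key : ∀ B, MeasurableSet[MeasurableSpace.generateFrom
      {S : Set X | ∃ j, 1 ≤ j ∧ ∃ i ≤ C.h j, S = (⇑C.T)^[i] '' C.E j}] B →
      MeasurableSet B ∧ Apx C B := by
    intro B hB
    induction B, hB using MeasurableSpace.generateFrom_induction with
    | hC t ht _ =>
      obtain ⟨j, hj, i, hi, rfl⟩ := ht
      have := HH_eq C j hj
      have h1 := measurableSet_Lv C j i
      have h2 := apx_Lv C hj (i := i) (by omega) (by omega)
      simp only [Lv, Int.toNat_natCast] at h1 h2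
      exact ⟨h1, h2⟩
    | empty => exact ⟨MeasurableSet.empty, apx_empty C⟩
    | compl t _ ih => exact ⟨ih.1.compl, apx_compl C ih.2⟩
    | iUnion f _ ih =>
      exact ⟨MeasurableSet.iUnion (fun n => (ih n).1), apx_iUnion C (fun n => (ih n).1)
        (fun n => (ih n).2)⟩
  exact (key B hB).2

theorem rho_zero_iter (C : ChaconMap μ (fun j => j)) {A : Set X} {d : ℕ} (h : rho C A d = 0)
    (k : ℕ) : ((⇑C.T)^[d * k] ⁻¹' A : Set X) =ᵐ[μ] A := by
  have h1 : μ (A ∆ ((⇑C.T)^[d] ⁻¹' A)) = 0 := by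
    have := (ENNReal.toReal_eq_zero_iff _).1 h
    rcases this with h | h
    · exact h
    · exact absurd h (measure_ne_top _ _)
  have h2 := (measure_symmDiff_eq_zero_iff.1 h1).symm
  rw [Function.iterate_mul]
  exact (mp_iter C d).quasiMeasurePreserving.preimage_iterate_ae_eq k h2

theorem rho_zero_mul (C : ChaconMap μ (fun j => j)) {A : Set X} {d : ℕ} (h : rho C A d = 0)
    (k : ℕ) : rho C A (d * k) = 0 := by
  have := measure_symmDiff_eq_zero_iff.2 (rho_zero_iter C h k).symm
  rw [rho, Measure.real, this]; simp

theorem ergodic_aux (C : ChaconMap μ (fun j => j)) {A : Set X} (hA : MeasurableSet A)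
    (h : rho C A 1 = 0) : μ A = 0 ∨ μ A = 1 := by
  have hlev : ∀ j (i : ℤ), μ.real (A ∩ Lv C j i) = μ.real (A ∩ C.E j) := by
    intro j i
    have h1 := rho_zero_iter C h i.toNat
    rw [one_mul] at h1
    have h2 : (⇑C.T)^[i.toNat] ⁻¹' (A ∩ Lv C j i) = ((⇑C.T)^[i.toNat] ⁻¹' A) ∩ C.E j := by
      rw [Set.preimage_inter, Lv, Set.preimage_image_eq _ (C.T.injective.iterate _)]
    have h3 : μ.real ((⇑C.T)^[i.toNat] ⁻¹' (A ∩ Lv C j i)) = μ.real (A ∩ Lv C j i) := by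
      simp only [Measure.real]
      rw [(mp_iter C _).measure_preimage (hA.inter (measurableSet_Lv C j i)).nullMeasurableSet]
    rw [← h3, h2]
    exact measureReal_congr (h1.inter (ae_eq_refl _))
  have hsum : ∀ j, 1 ≤ j → ∀ S : Finset ℤ, (∀ i ∈ S, 0 ≤ i ∧ i < HH j) →
      μ.real (A ∩ ⋃ i ∈ S, Lv C j i) = S.card * μ.real (A ∩ C.E j) := by
    intro j hj S hS
    rw [Set.inter_iUnion₂, measureReal_biUnion_finset]
    · simp [hlev]
    · intro i hi i' hi' hne
      exact (disjoint_Lv C hj (hS i hi).1 (hS i hi).2 (hS i' hi').1 (hS i' hi').2 hne).mono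
        Set.inter_subset_right Set.inter_subset_right
    · intro i _; exact hA.inter (measurableSet_Lv C j i)
  set a := μ.real A with ha
  have ha0 : 0 ≤ a := measureReal_nonneg
  have ha1 : a ≤ 1 := measureReal_le_one
  have key : ∀ ε : ℝ, 0 < ε → a - a * a ≤ 3 * ε := by
    intro ε hε
    obtain ⟨j0, h0, hj⟩ := apx_all C hA ε hε
    obtain ⟨j1, hj1⟩ := eventually_atTop.1 ((tendsto_compl C).eventually (gt_mem_nhds hε))
    obtain ⟨v, hv⟩ := hj (max j0 j1) (by omega)
    have hδ := hj1 (max j0 j1) (by omega)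
    set j := max j0 j1
    have hj' : 1 ≤ j := by omega
    have e1 := hsum j hj' ((Finset.Ico 0 (HH j)).filter (fun i => v i = true))
      (fun i hi => Finset.mem_Ico.1 (Finset.mem_filter.1 hi).1)
    have e2 := hsum j hj' (Finset.Ico 0 (HH j)) (fun i hi => Finset.mem_Ico.1 hi)
    have e3 := measure_biUnion_Lv C hj' ((Finset.Ico 0 (HH j)).filter (fun i => v i = true))
      (fun i hi => Finset.mem_Ico.1 (Finset.mem_filter.1 hi).1)
    have e4 := measure_biUnion_Lv C hj' (Finset.Ico 0 (HH j)) (fun i hi => Finset.mem_Ico.1 hi)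
    rw [← Bset] at e1 e3
    rw [← tow] at e2 e4
    have e5 : μ.real (A ∩ Bset C j v) * μ.real (tow C j) =
        μ.real (Bset C j v) * μ.real (A ∩ tow C j) := by
      rw [e1, e2, e3, e4]; ring
    rw [probReal_compl_eq_one_sub (measurableSet_tow C j)] at hδ
    have i1 : a ≤ μ.real (A ∩ Bset C j v) + ε := by
      have : A ⊆ (A ∩ Bset C j v) ∪ (A ∆ Bset C j v) := by
        intro x; simp only [Set.mem_symmDiff, Set.mem_union, Set.mem_inter_iff]; tauto
      have := (measureReal_mono (μ := μ) this).trans (measureReal_union_le _ _)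
      linarith
    have i2 : μ.real (Bset C j v) ≤ a + ε := by
      have : Bset C j v ⊆ A ∪ (A ∆ Bset C j v) := by
        intro x; simp only [Set.mem_symmDiff, Set.mem_union]; tauto
      have := (measureReal_mono (μ := μ) this).trans (measureReal_union_le _ _)
      linarith
    have i3 : μ.real (A ∩ tow C j) ≤ a := measureReal_mono Set.inter_subset_left
    have i4 : μ.real (A ∩ Bset C j v) ≤ 1 := measureReal_le_one
    have i5 : 0 ≤ μ.real (A ∩ Bset C j v) := measureReal_nonneg
    have i6 : 0 ≤ μ.real (A ∩ tow C j) := measureReal_nonneg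
    have i7 : 0 ≤ μ.real (Bset C j v) := measureReal_nonneg
    have i8 : μ.real (Bset C j v) * μ.real (A ∩ tow C j) ≤ (a + ε) * a := by gcongr
    nlinarith
  have h0 : a - a * a ≤ 0 := by
    by_contra hne
    push Not at hne
    have := key ((a - a*a)/6) (by linarith)
    linarith
  have h1 : a * (1 - a) = 0 := by nlinarith
  rcases mul_eq_zero.1 h1 with h | h
  · left
    exact (measureReal_eq_zero_iff).1 h
  · right
    have : a = 1 := by linarith
    rw [ha, Measure.real] at this
    rw [← ENNReal.toReal_eq_one_iff]; exact this

theorem conv_density (C : ChaconMap μ (fun j => j)) {J : ℕ} (hJ : 1 ≤ J) {q x : ℝ} :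
    q ≤ x * μ.real (C.E J) ↔ q / (3 * μ.real (C.E 1)) * 3 ^ J ≤ x := by
  have h := measure_E_pow C hJ
  have hk := kappa_pos C
  have h3 : (0:ℝ) < 3 ^ J := by positivity
  have he : 0 < μ.real (C.E J) := by
    by_contra hne
    nlinarith
  have : q / (3 * μ.real (C.E 1)) * 3 ^ J = q / μ.real (C.E J) := by
    rw [← h]; field_simp
  rw [this, div_le_iff₀ he]

theorem rho_lower (C : ChaconMap μ (fun j => j)) {A : Set X} (hA : MeasurableSet A)
    (hne : ¬ (μ A = 0 ∨ μ A = 1)) : ∃ c : ℝ, 0 < c ∧ ∀ d : ℕ, 1 ≤ d → c ≤ rho C A d := by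
  have hp : 0 < rho C A 1 := by
    rcases eq_or_lt_of_le (show 0 ≤ rho C A 1 from measureReal_nonneg) with h | h
    · exact absurd (ergodic_aux C hA h.symm) hne
    · exact h
  set p := rho C A 1 with hpdef
  obtain ⟨j0, h0, hj⟩ := apx_all C hA (p/1000) (by positivity)
  obtain ⟨v, hv⟩ := hj j0 le_rfl
  have hd := desc_Bset C v h0
  set B := Bset C j0 v
  have hB : MeasurableSet B := hd.2.2.1
  have h1 := rho_approx C hA hB 1
  obtain ⟨j1, hj1, hq⟩ := exists_mis_ge C hd 1 (q := p/2) (by linarith)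
  rw [conv_density C (by omega)] at hq
  have big : ∀ d : ℕ, HH j1 + j1 + 1 ≤ d → p/100 ≤ rho C A d := by
    intro d hdd
    have := HH_ge (d + j0)
    have h2 := comb_pass hd.2.1 h0 hj1 hq hdd (J := d + j0) (by push_cast at this; omega)
    rw [div_right_comm, ← conv_density C (by omega)] at h2
    have h3 := mis_le_rho C hd (j := d + j0 + 2) (by omega) d
    have h4 := rho_approx C hB hA d
    rw [symmDiff_comm] at h4
    linarith
  have pos : ∀ d : ℕ, 1 ≤ d → 0 < rho C A d := by
    intro d hd1
    rcases eq_or_lt_of_le (show 0 ≤ rho C A d from measureReal_nonneg) with h | h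
    · exfalso
      have h2 := rho_zero_mul C h.symm (HH j1 + j1 + 1).toNat
      have h3 := big (d * (HH j1 + j1 + 1).toNat) (by
        have : (HH j1 + j1 + 1).toNat ≤ d * (HH j1 + j1 + 1).toNat := Nat.le_mul_of_pos_left _ hd1
        omega)
      linarith
    · exact h
  set N := (HH j1 + j1 + 1).toNat
  have fin : ∀ N : ℕ, ∃ c : ℝ, 0 < c ∧ ∀ d : ℕ, 1 ≤ d → d < N → c ≤ rho C A d := by
    intro N
    induction N with
    | zero => exact ⟨1, one_pos, fun d _ h => absurd h (by omega)⟩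
    | succ k ih =>
      obtain ⟨c, hc, h⟩ := ih
      by_cases hk : 1 ≤ k
      · refine ⟨min c (rho C A k), lt_min hc (pos k hk), fun d h1 h2 => ?_⟩
        rcases Nat.lt_succ_iff_lt_or_eq.1 h2 with h3 | rfl
        · exact (min_le_left _ _).trans (h d h1 h3)
        · exact min_le_right _ _
      · exact ⟨c, hc, fun d h1 h2 => absurd h2 (by omega)⟩
  obtain ⟨c, hc, h⟩ := fin N
  refine ⟨min c (p/100), lt_min hc (by positivity), fun d hd1 => ?_⟩
  by_cases hN : d < N
  · exact (min_le_left _ _).trans (h d hd1 hN)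
  · exact (min_le_right _ _).trans (big d (by omega))

theorem lemA (C : ChaconMap μ (fun j => j)) {A B : Set X} (hA : MeasurableSet A) {c : ℝ}
    (hc : 0 < c) (hrho : ∀ d : ℕ, 1 ≤ d → c ≤ rho C A d) {w : ℕ → ℤ → Bool} {j0 : ℕ}
    (hd : Desc C B w j0) (hAB : μ.real (A ∆ B) < c / 8) :
    ∃ J1, j0 ≤ J1 ∧ ∀ J, J1 ≤ J → ∀ d : ℤ, 1 ≤ d → d ≤ HH J →
      c / 2 / (3 * μ.real (C.E 1)) / 27 * 3 ^ (J+2) ≤ mis (w (J+2)) (HH (J+2)) d := by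
  have hB : MeasurableSet B := hd.2.2.1
  have hk := kappa_pos C
  have hrB : ∀ d : ℕ, 1 ≤ d → c / 2 < rho C B d := by
    intro d h1
    have := rho_approx C hA hB d
    have := hrho d h1
    linarith
  have hex : ∀ d : ℕ, 1 ≤ d → ∃ J, j0 ≤ J ∧ c / 2 / (3 * μ.real (C.E 1)) * 3 ^ J ≤
      mis (w J) (HH J) d := by
    intro d h1
    obtain ⟨J, hJ, h⟩ := exists_mis_ge C hd d (hrB d h1)
    exact ⟨J, hJ, (conv_density C (hd.1.trans hJ)).1 h⟩
  obtain ⟨j1, hj1, hq⟩ := hex 1 le_rfl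
  have fin : ∀ N : ℕ, ∃ J1, j0 ≤ J1 ∧ ∀ d : ℕ, 1 ≤ d → d < N →
      c / 2 / (3 * μ.real (C.E 1)) * 3 ^ J1 ≤ mis (w J1) (HH J1) d := by
    intro N
    induction N with
    | zero => exact ⟨j0, le_rfl, fun d _ h => absurd h (by omega)⟩
    | succ k ih =>
      obtain ⟨J1, hJ1, h⟩ := ih
      by_cases hk : 1 ≤ k
      · obtain ⟨J, hJ, h'⟩ := hex k hk
        refine ⟨max J J1, by omega, fun d h1 h2 => ?_⟩
        rcases Nat.lt_succ_iff_lt_or_eq.1 h2 with h3 | rfl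
        · exact mis_lb_mono hd.2.1 hd.1 hJ1 (by omega) (h d h1 h3)
        · exact mis_lb_mono hd.2.1 hd.1 hJ (by omega) h'
      · exact ⟨J1, hJ1, fun d h1 h2 => absurd h2 (by omega)⟩
  obtain ⟨J1, hJ1, h⟩ := fin (HH j1 + j1 + 1).toNat
  refine ⟨J1, hJ1, fun J hJ d h1 h2 => ?_⟩
  by_cases hdN : HH j1 + j1 + 1 ≤ d
  · exact comb_pass hd.2.1 hd.1 hj1 hq hdN h2
  · have h3 := h d.toNat (by omega) (by omega)
    rw [Int.toNat_of_nonneg (by omega)] at h3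
    have h4 := mis_lb_mono hd.2.1 hd.1 hJ1 (show J1 ≤ J + 2 by omega) h3
    refine le_trans ?_ h4
    refine mul_le_mul_of_nonneg_right ?_ (by positivity)
    apply div_le_self
    · positivity
    · norm_num

end approx

section joining
set_option linter.unusedSectionVars false
variable {X : Type*} [m : MeasurableSpace X] {μ : Measure X} [IsProbabilityMeasure μ]

/-- symmetric self-joining-like bilinear forms -/
structure JForm (C : ChaconMap μ (fun j => j)) (nu : Set X → Set X → ℝ) : Prop where
  nonneg : ∀ B D, 0 ≤ nu B D
  symm : ∀ B D, nu B D = nu D B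
  add : ∀ B B' D, MeasurableSet B → MeasurableSet B' → MeasurableSet D → Disjoint B B' →
    nu (B ∪ B') D = nu B D + nu B' D
  le : ∀ B D, MeasurableSet B → MeasurableSet D → nu B D ≤ μ.real B
  inv : ∀ B D, MeasurableSet B → MeasurableSet D → nu (⇑C.T '' B) (⇑C.T '' D) = nu B D

namespace JForm
variable {C : ChaconMap μ (fun j => j)} {nu : Set X → Set X → ℝ}

theorem mono (h : JForm C nu) {B B' D : Set X} (hB : MeasurableSet B) (hB' : MeasurableSet B')
    (hD : MeasurableSet D) (hs : B ⊆ B') : nu B D ≤ nu B' D := by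
  have := h.add B (B' \ B) D hB (hB'.diff hB) hD Set.disjoint_sdiff_right
  rw [Set.union_sdiff_cancel hs] at this
  have := h.nonneg (B' \ B) D
  linarith

theorem empty (h : JForm C nu) {D : Set X} (hD : MeasurableSet D) : nu ∅ D = 0 := by
  have := h.le ∅ D MeasurableSet.empty hD
  have := h.nonneg ∅ D
  simp at *; linarith

theorem approx (h : JForm C nu) {B B' D : Set X} (hB : MeasurableSet B) (hB' : MeasurableSet B')
    (hD : MeasurableSet D) : nu B D ≤ nu B' D + μ.real (B ∆ B') := by
  have h1 := h.add (B ∩ B') (B \ B') D (hB.inter hB') (hB.diff hB') hD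
    (Set.disjoint_left.2 fun x hx hx' => hx'.2 hx.2)
  rw [Set.inter_union_sdiff] at h1
  have h2 := h.mono (hB.inter hB') hB' hD Set.inter_subset_right
  have h3 := h.le (B \ B') D (hB.diff hB') hD
  have h4 : μ.real (B \ B') ≤ μ.real (B ∆ B') := measureReal_mono (by
    intro x hx; exact Or.inl hx)
  linarith

theorem sum_left (h : JForm C nu) {L : ℤ → Set X} (S : Finset ℤ) {D : Set X}
    (hL : ∀ i, MeasurableSet (L i)) (hD : MeasurableSet D)
    (hdis : ∀ i ∈ S, ∀ i' ∈ S, i ≠ i' → Disjoint (L i) (L i')) :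
    nu (⋃ i ∈ S, L i) D = ∑ i ∈ S, nu (L i) D := by
  induction S using Finset.induction_on with
  | empty => simpa using h.empty hD
  | insert a S ha ih =>
    rw [Finset.sum_insert ha, ← ih, ← h.add]
    · congr 1
      rw [Finset.set_biUnion_insert]
    · exact hL a
    · exact Finset.measurableSet_biUnion _ (fun i _ => hL i)
    · exact hD
    · rw [Set.disjoint_iUnion₂_right]
      intro i hi
      refine hdis a (by simp) i (by simp [hi]) ?_
      rintro rfl; exact ha hi
    · intro i hi i' hi'
      exact hdis i (by simp [hi]) i' (by simp [hi'])

theorem sum_right (h : JForm C nu) {L : ℤ → Set X} (S : Finset ℤ) {D : Set X}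
    (hL : ∀ i, MeasurableSet (L i)) (hD : MeasurableSet D)
    (hdis : ∀ i ∈ S, ∀ i' ∈ S, i ≠ i' → Disjoint (L i) (L i')) :
    nu D (⋃ i ∈ S, L i) = ∑ i ∈ S, nu D (L i) := by
  rw [h.symm, h.sum_left S hL hD hdis]
  exact Finset.sum_congr rfl fun i _ => h.symm _ _

theorem iter (h : JForm C nu) {B D : Set X} (hB : MeasurableSet B) (hD : MeasurableSet D)
    (k : ℕ) : nu ((⇑C.T)^[k] '' B) ((⇑C.T)^[k] '' D) = nu B D := by
  induction k with
  | zero => simp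
  | succ n ih =>
    rw [Function.iterate_succ', Set.image_comp, Set.image_comp, h.inv, ih]
    · rw [image_iter]; exact (mp_symm C _).measurable hB
    · rw [image_iter]; exact (mp_symm C _).measurable hD

theorem lev (h : JForm C nu) {J : ℕ} {i i' : ℤ} (hi : 0 ≤ i) (hi' : 0 ≤ i') :
    nu (Lv C J i) (Lv C J i') = nu (Lv C J 0) (Lv C J |i' - i|) := by
  have key : ∀ i i' : ℤ, 0 ≤ i → i ≤ i' →
      nu (Lv C J i) (Lv C J i') = nu (Lv C J 0) (Lv C J (i' - i)) := by
    intro i i' h0 h1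
    rw [← h.iter (measurableSet_Lv C J 0) (measurableSet_Lv C J (i' - i)) i.toNat]
    unfold Lv
    rw [← Set.image_comp, ← Set.image_comp, ← Function.iterate_add, ← Function.iterate_add]
    congr 4
    omega
  rcases le_total i i' with h1 | h1
  · rw [key i i' hi h1, abs_of_nonneg (by omega)]
  · rw [h.symm, key i' i hi' h1, abs_of_nonpos (by omega), neg_sub]

/-- the mismatch sum -/
noncomputable def SS (C : ChaconMap μ (fun j => j)) (nu : Set X → Set X → ℝ) (J : ℕ)
    (v : ℤ → Bool) : ℝ :=
  ∑ D ∈ Finset.Ioo (-HH J) (HH J), nu (Lv C J 0) (Lv C J |D|) * mis v (HH J) D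

theorem SS_eq (h : JForm C nu) {J : ℕ} (hJ : 1 ≤ J) (v : ℤ → Bool) :
    SS C nu J v = 2 * nu (Bset C J v) (Bset C J (fun i => !(v i))) := by
  classical
  set H := HH J with hH
  set I := Finset.Ico (0:ℤ) H with hI
  set f : ℤ × ℤ → ℝ := fun p => nu (Lv C J p.1) (Lv C J p.2) with hf
  set M := (I ×ˢ I).filter (fun p => v p.1 ≠ v p.2) with hM
  have h1 : ∑ p ∈ M, f p = SS C nu J v := by
    rw [← Finset.sum_fiberwise_of_maps_to (s := M) (t := Finset.Ioo (-H) H)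
      (g := fun p => p.2 - p.1)]
    · unfold SS
      refine Finset.sum_congr rfl fun D hD => ?_
      have hc : ((M.filter (fun p => p.2 - p.1 = D)).card : ℝ) = mis v H D := by
        unfold mis
        norm_cast
        symm
        refine Finset.card_bij (fun i _ => (i, i + D)) ?_ ?_ ?_
        · intro i hi
          rw [mem_misSet] at hi
          simp [hM, hI]
          tauto
        · intro i _ i' _ he
          exact (Prod.mk.inj he).1
        · rintro ⟨a, b⟩ hp
          simp [hM, hI] at hp
          refine ⟨a, ?_, ?_⟩
          · rw [mem_misSet]
            obtain ⟨⟨⟨⟨h1, h2⟩, h3, h4⟩, h5⟩, h6⟩ := hp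
            have : a + D = b := by omega
            rw [this]; tauto
          · have : a + D = b := by omega
            rw [this]
      rw [← hc, mul_comm, ← nsmul_eq_mul, ← Finset.sum_const]
      refine Finset.sum_congr rfl fun p hp => ?_
      simp [hM, hI] at hp
      rw [← hp.2]
      exact h.lev (by tauto) (by tauto)
    · rintro ⟨a, b⟩ hp
      simp [hM, hI] at hp
      rw [Finset.mem_Ioo]
      dsimp only
      omega
  have hPQ : ∀ u u' : ℤ → Bool, nu (Bset C J u) (Bset C J u') =
      ∑ p ∈ (I ×ˢ I).filter (fun p => u p.1 = true ∧ u' p.2 = true), f p := by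
    intro u u'
    have hd : ∀ u : ℤ → Bool, ∀ i ∈ I.filter (fun i => u i = true),
        ∀ i' ∈ I.filter (fun i => u i = true), i ≠ i' → Disjoint (Lv C J i) (Lv C J i') := by
      intro u i hi i' hi' hne
      simp [hI] at hi hi'
      exact disjoint_Lv C hJ hi.1.1 hi.1.2 hi'.1.1 hi'.1.2 hne
    have e1 : Bset C J u = ⋃ i ∈ I.filter (fun i => u i = true), Lv C J i := rfl
    rw [e1, h.sum_left _ (measurableSet_Lv C J) (measurableSet_Bset C J u') (hd u)]
    have e2 : Bset C J u' = ⋃ i ∈ I.filter (fun i => u' i = true), Lv C J i := rfl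
    rw [e2]
    have e3 : (I ×ˢ I).filter (fun p => u p.1 = true ∧ u' p.2 = true) =
        I.filter (fun i => u i = true) ×ˢ I.filter (fun i => u' i = true) := by
      refine Finset.ext fun p => ?_
      simp only [Finset.mem_filter, Finset.mem_product]
      tauto
    rw [e3, Finset.sum_product]
    refine Finset.sum_congr rfl fun i _ => ?_
    rw [h.sum_right _ (measurableSet_Lv C J) (measurableSet_Lv C J i) (hd u')]
  have h2 : nu (Bset C J v) (Bset C J (fun i => !(v i))) +
      nu (Bset C J (fun i => !(v i))) (Bset C J v) = ∑ p ∈ M, f p := by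
    rw [hPQ, hPQ, ← Finset.sum_union]
    · congr 1
      rw [hM, ← Finset.filter_or]
      refine Finset.filter_congr fun p _ => ?_
      cases v p.1 <;> cases v p.2 <;> simp
    · rw [Finset.disjoint_filter]
      intro p _
      cases v p.1 <;> simp
  rw [← h1, ← h2, h.symm (Bset C J (fun i => !(v i)))]
  ring

theorem SS_le (h : JForm C nu) {J : ℕ} (hJ : 1 ≤ J) (v : ℤ → Bool) :
    SS C nu J v ≤ 2 * nu (Bset C J v) (Bset C J v)ᶜ := by
  rw [h.SS_eq hJ]
  have : Bset C J (fun i => !(v i)) ⊆ (Bset C J v)ᶜ := by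
    intro x hx hx2
    obtain ⟨i, h1, h2, h3, h4⟩ := (mem_Bset C).1 hx
    rw [mem_Bset_of_Lv C hJ h1 h2 h4] at hx2
    simp [hx2] at h3
  have := h.mono (measurableSet_Bset C _ _) (measurableSet_Bset C _ _).compl
    (measurableSet_Bset C J v) this
  rw [h.symm, h.symm (Bset C J v)ᶜ] at this
  linarith

theorem le_SS (h : JForm C nu) {J : ℕ} (hJ : 1 ≤ J) (v : ℤ → Bool) :
    nu (Bset C J v) (Bset C J v)ᶜ ≤ SS C nu J v + μ.real (tow C J)ᶜ := by
  rw [h.SS_eq hJ]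
  have hm := measurableSet_Bset C J v
  have hm' := measurableSet_Bset C J (fun i => !(v i))
  have ht := (measurableSet_tow C J).compl
  have hs : (Bset C J v)ᶜ ⊆ Bset C J (fun i => !(v i)) ∪ (tow C J)ᶜ := by
    intro x hx
    by_cases hxt : x ∈ tow C J
    · left
      obtain ⟨i, h1, h2, h4⟩ := (mem_tow C).1 hxt
      have : ¬ (v i = true) := fun h => hx ((mem_Bset_of_Lv C hJ h1 h2 h4).2 h)
      rw [mem_Bset_of_Lv C hJ h1 h2 h4]
      simpa using this
    · exact Or.inr hxt
  have h1 := h.mono hm.compl (hm'.union ht) hm hs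
  have h2 := h.add (Bset C J (fun i => !(v i))) (tow C J)ᶜ (Bset C J v) hm' ht hm (by
    rw [Set.disjoint_compl_right_iff_subset]
    intro x hx
    obtain ⟨i, h1, h2, h3, h4⟩ := (mem_Bset C).1 hx
    exact (mem_tow C).2 ⟨i, h1, h2, h4⟩)
  have h3 := h.le _ _ ht hm
  have h4 := h.nonneg (Bset C J v) (Bset C J (fun i => !(v i)))
  have h5 := h.symm (Bset C J v) (Bset C J (fun i => !(v i)))
  have h6 := h.symm (Bset C J v) (Bset C J v)ᶜ
  linarith

theorem sum_b (h : JForm C nu) {J : ℕ} (hJ : 1 ≤ J) :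
    ∑ D ∈ Finset.Ioo (-HH J) (HH J), nu (Lv C J 0) (Lv C J |D|) ≤ 2 * μ.real (C.E J) := by
  classical
  have h1 : ∑ D ∈ Finset.Ico 0 (HH J), nu (Lv C J 0) (Lv C J |D|) ≤ μ.real (C.E J) := by
    have := h.sum_right (L := Lv C J) (Finset.Ico 0 (HH J)) (measurableSet_Lv C J)
      (measurableSet_Lv C J 0) (by
        intro i hi i' hi' hne
        simp at hi hi'
        exact disjoint_Lv C hJ hi.1 hi.2 hi'.1 hi'.2 hne)
    have h2 : ∑ D ∈ Finset.Ico 0 (HH J), nu (Lv C J 0) (Lv C J |D|) =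
        ∑ D ∈ Finset.Ico 0 (HH J), nu (Lv C J 0) (Lv C J D) := by
      refine Finset.sum_congr rfl fun D hD => ?_
      rw [abs_of_nonneg (Finset.mem_Ico.1 hD).1]
    rw [h2, ← this, ← real_Lv C J 0]
    exact h.le _ _ (measurableSet_Lv C J 0) (measurableSet_tow C J)
  have hsub : Finset.Ioo (-HH J) (HH J) ⊆ Finset.Ico 0 (HH J) ∪
      (Finset.Ico 0 (HH J)).image (fun x => -x) := by
    intro D hD
    simp at hD
    rw [Finset.mem_union, Finset.mem_image]
    rcases le_total 0 D with h | h
    · left; simp; omega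
    · right; exact ⟨-D, by simp; omega, by simp⟩
  refine (Finset.sum_le_sum_of_subset_of_nonneg hsub (fun i _ _ => h.nonneg _ _)).trans ?_
  have h3 := Finset.sum_union_inter (s₁ := Finset.Ico 0 (HH J))
    (s₂ := (Finset.Ico 0 (HH J)).image (fun x => -x))
    (f := fun D => nu (Lv C J 0) (Lv C J |D|))
  have h4 : 0 ≤ ∑ D ∈ Finset.Ico 0 (HH J) ∩ (Finset.Ico 0 (HH J)).image (fun x => -x),
    nu (Lv C J 0) (Lv C J |D|) := Finset.sum_nonneg (fun i _ => h.nonneg _ _)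
  have h5 : ∑ D ∈ (Finset.Ico 0 (HH J)).image (fun x => -x), nu (Lv C J 0) (Lv C J |D|) =
      ∑ D ∈ Finset.Ico 0 (HH J), nu (Lv C J 0) (Lv C J |D|) := by
    rw [Finset.sum_image (fun a _ b _ hab => neg_injective hab)]
    simp only [abs_neg]
  linarith

/-- main estimate -/
theorem main_est (h : JForm C nu) {A : Set X} (hA : MeasurableSet A)
    (hne : ¬ (μ A = 0 ∨ μ A = 1)) (hnu : nu A Aᶜ = 0) {B : Set X} {w' : ℕ → ℤ → Bool} {j' : ℕ}
    (hB : Desc C B w' j') : nu B Bᶜ = 0 := by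
  obtain ⟨c2, hc2, hrho⟩ := rho_lower C hA hne
  refine le_antisymm (le_of_forall_pos_le_add fun η hη => ?_) (h.nonneg _ _)
  have hk := kappa_pos C
  set c := c2 / 2 / (3 * μ.real (C.E 1)) / 27 with hc
  have hcpos : 0 < c := by positivity
  obtain ⟨n, hn⟩ := exists_pow_lt_of_lt_one (show 0 < η / 6 by positivity)
    (show (1/3 : ℝ) < 1 by norm_num)
  set K := 27 * 3 ^ n / c with hK
  have hKpos : 0 < K := by positivity
  set ε := min (c2 / 8) (η / 3 / (4 * K)) with hε
  have hεpos : 0 < ε := lt_min (by positivity) (by positivity)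
  have hεK : K * (4 * ε) ≤ η / 3 := by
    have : ε ≤ η / 3 / (4 * K) := min_le_right _ _
    rw [le_div_iff₀ (by positivity)] at this
    linarith
  obtain ⟨j0, h0, hap⟩ := apx_all C hA ε hεpos
  obtain ⟨v, hv⟩ := hap j0 le_rfl
  have hd := desc_Bset C v h0
  set A' := Bset C j0 v with hA'
  set w := wx v j0 with hw
  obtain ⟨J1, hJ1, hlem⟩ := lemA C hA hc2 hrho hd (hv.trans_le (min_le_left _ _))
  obtain ⟨j1, hj1⟩ := eventually_atTop.1 ((tendsto_compl C).eventually
    (gt_mem_nhds (show (0:ℝ) < η/3 by positivity)))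
  set j := max (J1 + 8) (max j' j1) with hj
  have hδ := hj1 (j + n) (by omega)
  have hj'1 := hB.1
  have hcomb := comb_main hd.2.1 hd.1 hcpos.le hJ1 hlem (show J1 + 8 ≤ j by omega)
    (hB.2.1.mono (show j' ≤ j by omega)) n
  set J := j + n with hJdef
  have hJ : 1 ≤ J := by omega
  have hHJ : (HH J : ℝ) ≤ 3 ^ J := by
    have := HH_le_pow J hJ
    have : HH J ≤ 3 ^ J := by omega
    exact_mod_cast this
  have hHj0 : (0:ℝ) < HH j := by exact_mod_cast HH_pos j
  have term : ∀ D ∈ Finset.Ioo (-HH J) (HH J),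
      (mis (w' J) (HH J) D : ℝ) ≤ K * mis (w J) (HH J) D + HH j := by
    have t0 : ∀ D : ℤ, 0 ≤ D → D < HH J →
        (mis (w' J) (HH J) D : ℝ) ≤ K * mis (w J) (HH J) D + HH j := by
      intro D h1 h2
      have hnn : (0:ℝ) ≤ K * mis (w J) (HH J) D := by positivity
      by_cases hD : D ≤ HH J - HH j
      · rcases hcomb D h1 hD with h3 | h3
        · have h4 : (mis (w' J) (HH J) D : ℝ) ≤ HH J := by
            exact_mod_cast mis_le (w' J) (HH J) D (HH_pos J).le
          have h5 : K * (c / 27 * 3 ^ j) = 3 ^ J := by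
            rw [hK, hJdef, pow_add]; field_simp
          have h6 := mul_le_mul_of_nonneg_left h3 hKpos.le
          linarith
        · rw [h3]; push_cast; linarith
      · have h4 := mis_le_sub (w' J) (HH J) D (by omega)
        have h5 : (mis (w' J) (HH J) D : ℝ) ≤ HH j := by
          have : (mis (w' J) (HH J) D : ℤ) ≤ HH j := by omega
          exact_mod_cast this
        linarith
    intro D hD
    rw [Finset.mem_Ioo] at hD
    rcases le_total 0 D with h1 | h1
    · exact t0 D h1 hD.2
    · have := t0 (-D) (by omega) (by omega)
      rwa [mis_neg, mis_neg] at this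
  have hSS : SS C nu J (w' J) ≤ K * SS C nu J (w J) + HH j * (2 * μ.real (C.E J)) := by
    refine le_trans ?_ (add_le_add_right (mul_le_mul_of_nonneg_left (h.sum_b hJ) hHj0.le) _)
    unfold SS
    rw [Finset.mul_sum, Finset.mul_sum, ← Finset.sum_add_distrib]
    refine Finset.sum_le_sum fun D hD => ?_
    have := mul_le_mul_of_nonneg_left (term D hD) (h.nonneg (Lv C J 0) (Lv C J |D|))
    linarith
  have hBm := hB.2.2.1
  have hBset := measurableSet_Bset C J (w' J)
  have hBae := hB.2.2.2 J (by omega)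
  have zero_of : ∀ {P Q : Set X}, P =ᵐ[μ] Q → μ.real (P ∆ Q) = 0 := by
    intro P Q hPQ
    rw [Measure.real, measure_symmDiff_eq_zero_iff.2 hPQ]; simp
  -- comparing forms of sets
  have cmp : ∀ P Q : Set X, MeasurableSet P → MeasurableSet Q →
      nu P Pᶜ ≤ nu Q Qᶜ + 2 * μ.real (P ∆ Q) := by
    intro P Q hP hQ
    have h1 := h.approx hP hQ hP.compl
    have h2 := h.approx hP.compl hQ.compl hQ
    rw [h.symm Pᶜ, h.symm Qᶜ] at h2
    have h3 : Pᶜ ∆ Qᶜ = P ∆ Q := by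
      refine Set.ext fun x => ?_
      simp only [Set.mem_symmDiff, Set.mem_compl_iff]; tauto
    rw [h3] at h2
    linarith
  have e1 := cmp B (Bset C J (w' J)) hBm hBset
  rw [zero_of hBae] at e1
  have e2 := cmp (Bset C J (w J)) A' (measurableSet_Bset C _ _) hd.2.2.1
  rw [symmDiff_comm, zero_of (hd.2.2.2 J (by omega))] at e2
  have e3 := cmp A' A hd.2.2.1 hA
  rw [hnu, symmDiff_comm] at e3
  have e4 := h.SS_le hJ (w J)
  have e5 := h.le_SS hJ (w' J)
  have e6 : K * SS C nu J (w J) ≤ K * (4 * ε) :=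
    mul_le_mul_of_nonneg_left (by linarith) hKpos.le
  have e7 : HH j * (2 * μ.real (C.E J)) ≤ η / 3 := by
    have a1 : (HH J : ℝ) * μ.real (C.E J) ≤ 1 := by
      rw [← real_tow C hJ]; exact measureReal_le_one
    have a2 : (3:ℝ) ^ n * HH j ≤ HH J := by exact_mod_cast HH_add j n (by omega)
    have a3 : (1/3 : ℝ) ^ n * 3 ^ n = 1 := by rw [← mul_pow]; norm_num
    have a4 : (3:ℝ) ^ n * HH j * μ.real (C.E J) ≤ 1 :=
      (mul_le_mul_of_nonneg_right a2 measureReal_nonneg).trans a1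
    have a5 := mul_le_mul_of_nonneg_left a4 (show (0:ℝ) ≤ (1/3 : ℝ) ^ n by positivity)
    have a6 : (1/3 : ℝ) ^ n * ((3:ℝ) ^ n * HH j * μ.real (C.E J)) = HH j * μ.real (C.E J) := by
      rw [← mul_assoc, ← mul_assoc, a3, one_mul]
    linarith
  linarith

end JForm
end joining

section factor
set_option linter.unusedSectionVars false
set_option linter.overlappingInstances false

/-- the completion of the factor algebra `F` inside `m` -/
def compl_alg {X : Type*} (F : MeasurableSpace X) [m : MeasurableSpace X] (μ : Measure X) :
    MeasurableSpace X where
  MeasurableSet' A := MeasurableSet[m] A ∧ ∃ B, MeasurableSet[F] B ∧ A =ᵐ[μ] B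
  measurableSet_empty := ⟨MeasurableSet.empty, ∅, @MeasurableSet.empty _ F, ae_eq_refl _⟩
  measurableSet_compl := by
    rintro A ⟨h1, B, hB, hAB⟩
    exact ⟨h1.compl, Bᶜ, @MeasurableSet.compl _ _ F hB, hAB.compl⟩
  measurableSet_iUnion := by
    intro f hf
    choose h1 B hB hAB using hf
    exact ⟨MeasurableSet.iUnion h1, ⋃ n, B n, @MeasurableSet.iUnion _ _ F _ _ hB,
      Filter.EventuallyEq.countable_iUnion hAB⟩

/-- conditional probability -/
noncomputable def cp {X : Type*} (G : MeasurableSpace X) [m : MeasurableSpace X] (μ : Measure X) (B : Set X) :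
    X → ℝ := μ[B.indicator (fun _ => (1:ℝ)) | G]

/-- the relatively independent self-joining -/
noncomputable def nuf {X : Type*} (G : MeasurableSpace X) [m : MeasurableSpace X] (μ : Measure X)
    (B D : Set X) : ℝ := ∫ x, cp G μ B x * cp G μ D x ∂μ

variable {X : Type*} {G : MeasurableSpace X} [m : MeasurableSpace X] {μ : Measure X}
  [IsProbabilityMeasure μ]

theorem int_ind {B : Set X} (hB : MeasurableSet B) :
    Integrable (B.indicator (fun _ => (1:ℝ))) μ := (integrable_const _).indicator hB

theorem cp_nonneg (B : Set X) : 0 ≤ᵐ[μ] cp G μ B :=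
  condExp_nonneg (ae_of_all _ fun x => Set.indicator_nonneg (fun _ _ => zero_le_one) x)

theorem cp_le_one (hG : G ≤ m) {B : Set X} (hB : MeasurableSet B) : cp G μ B ≤ᵐ[μ] fun _ => 1 := by
  have h := condExp_mono (m := G) (int_ind hB) (integrable_const (μ := μ) (1:ℝ))
    (ae_of_all _ fun x => Set.indicator_le_self' (fun _ _ => zero_le_one) x)
  rw [condExp_const hG] at h
  exact h

theorem cp_integrable (B : Set X) : Integrable (cp G μ B) μ := integrable_condExp

theorem cp_mul_integrable (hG : G ≤ m) {B D : Set X} (hB : MeasurableSet B) :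
    Integrable (fun x => cp G μ B x * cp G μ D x) μ := by
  refine (cp_integrable D).bdd_mul (c := 1) (cp_integrable B).aestronglyMeasurable ?_
  filter_upwards [cp_nonneg (G := G) (μ := μ) B, cp_le_one hG hB] with x h1 h2
  rw [Real.norm_eq_abs, abs_le]
  constructor
  · have : (0:ℝ) ≤ cp G μ B x := h1
    linarith
  · exact h2

theorem cp_comp {S : X ≃ᵐ X} (hG : G ≤ m) (hS : MeasurePreserving S μ μ)
    (h1 : ∀ A, MeasurableSet[G] A → MeasurableSet[G] (S ⁻¹' A))
    (h2 : ∀ A, MeasurableSet[G] A → MeasurableSet[G] (S.symm ⁻¹' A)) {B : Set X}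
    (hB : MeasurableSet B) : cp G μ (S ⁻¹' B) =ᵐ[μ] cp G μ B ∘ S := by
  symm
  have hgint : Integrable (cp G μ B ∘ S) μ := hS.integrable_comp_of_integrable (cp_integrable B)
  refine ae_eq_condExp_of_forall_setIntegral_eq hG (int_ind (S.measurable hB))
    (fun s _ _ => hgint.integrableOn) ?_ ?_
  · intro s hs _
    set t := S.symm ⁻¹' s with ht
    have hst : s = S ⁻¹' t := by
      rw [ht, ← Set.preimage_comp]; simp
    have htG : MeasurableSet[G] t := h2 s hs
    have e1 : ∫ x in s, (cp G μ B ∘ S) x ∂μ = ∫ x in t, cp G μ B x ∂μ := by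
      rw [hst]
      exact hS.setIntegral_preimage_emb S.measurableEmbedding _ _
    have e2 : ∫ x in t, cp G μ B x ∂μ = ∫ x in t, B.indicator (fun _ => (1:ℝ)) x ∂μ :=
      setIntegral_condExp hG (int_ind hB) htG
    have e3 : ∫ x in s, (S ⁻¹' B).indicator (fun _ => (1:ℝ)) x ∂μ =
        ∫ x in t, B.indicator (fun _ => (1:ℝ)) x ∂μ := by
      rw [hst]
      exact hS.setIntegral_preimage_emb S.measurableEmbedding
        (B.indicator (fun _ => (1:ℝ))) t
    rw [e1, e2, e3]
  · have : StronglyMeasurable[G] (cp G μ B) := stronglyMeasurable_condExp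
    have hm : Measurable[G, G] S := fun A hA => h1 A hA
    exact (this.comp_measurable hm).aestronglyMeasurable

theorem nuf_form (C : ChaconMap μ (fun j => j)) (hG : G ≤ m)
    (h1 : ∀ A, MeasurableSet[G] A → MeasurableSet[G] (C.T ⁻¹' A))
    (h2 : ∀ A, MeasurableSet[G] A → MeasurableSet[G] (C.T.symm ⁻¹' A)) :
    JForm C (nuf G μ) where
  nonneg B D := by
    refine integral_nonneg_of_ae ?_
    filter_upwards [cp_nonneg (G := G) (μ := μ) B, cp_nonneg (G := G) (μ := μ) D] with x h1 h2
    exact mul_nonneg h1 h2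
  symm B D := by simp only [nuf, mul_comm]
  add B B' D hB hB' hD hd := by
    unfold nuf
    rw [← integral_add (cp_mul_integrable hG hB) (cp_mul_integrable hG hB')]
    refine integral_congr_ae ?_
    have : cp G μ (B ∪ B') =ᵐ[μ] cp G μ B + cp G μ B' := by
      unfold cp
      rw [Set.indicator_union_of_disjoint hd]
      exact condExp_add (int_ind hB) (int_ind hB') G
    filter_upwards [this] with x hx
    rw [hx, Pi.add_apply, add_mul]
  le B D hB hD := by
    have e : ∫ x, cp G μ B x ∂μ = μ.real B := by
      unfold cp
      rw [integral_condExp hG]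
      simp [integral_indicator hB]
    rw [← e]
    refine integral_mono_ae (cp_mul_integrable hG hB) (cp_integrable B) ?_
    filter_upwards [cp_nonneg (G := G) (μ := μ) B, cp_le_one hG hD] with x h1 h2
    exact mul_le_of_le_one_right h1 h2
  inv B D hB hD := by
    have hS : MeasurePreserving C.T.symm μ μ := MeasurePreserving.symm C.T C.measurePreserving
    have k : ∀ B : Set X, ⇑C.T '' B = C.T.symm ⁻¹' B := fun B => by
      rw [← C.T.image_eq_preimage_symm]
    have hB' := cp_comp hG hS h2 h1 hB
    have hD' := cp_comp hG hS h2 h1 hD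
    rw [k, k]
    unfold nuf
    rw [← hS.integral_comp C.T.symm.measurableEmbedding (fun x => cp G μ B x * cp G μ D x)]
    refine integral_congr_ae ?_
    filter_upwards [hB', hD'] with x hx hx'
    rw [hx, hx']; rfl

theorem cp_self (hG : G ≤ m) {A : Set X} (hA : MeasurableSet[G] A) :
    cp G μ A = A.indicator (fun _ => (1:ℝ)) :=
  condExp_of_stronglyMeasurable hG
    (StronglyMeasurable.indicator stronglyMeasurable_const hA)
    (int_ind (hG A hA))

theorem nuf_self (hG : G ≤ m) {A : Set X} (hA : MeasurableSet[G] A) : nuf G μ A Aᶜ = 0 := by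
  unfold nuf
  rw [cp_self hG hA, cp_self hG (@MeasurableSet.compl _ _ G hA)]
  have : ∀ x, A.indicator (fun _ => (1:ℝ)) x * Aᶜ.indicator (fun _ => (1:ℝ)) x = 0 := by
    intro x
    by_cases h : x ∈ A <;> simp [h]
  simp [this]

theorem nuf_zero (hG : G ≤ m) {B : Set X} (hB : MeasurableSet B) (h : nuf G μ B Bᶜ = 0) :
    ∃ A, MeasurableSet[G] A ∧ B =ᵐ[μ] A := by
  have hsum : cp G μ B + cp G μ Bᶜ =ᵐ[μ] fun _ => 1 := by
    have e := condExp_add (int_ind (μ := μ) hB) (int_ind hB.compl) G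
    have : B.indicator (fun _ => (1:ℝ)) + Bᶜ.indicator (fun _ => (1:ℝ)) = fun _ => 1 := by
      funext x
      by_cases h : x ∈ B <;> simp [h]
    rw [this, condExp_const hG] at e
    exact e.symm
  have hz : (fun x => cp G μ B x * cp G μ Bᶜ x) =ᵐ[μ] 0 := by
    rw [← integral_eq_zero_iff_of_nonneg_ae ?_ (cp_mul_integrable hG hB)]
    · exact h
    · filter_upwards [cp_nonneg (G := G) (μ := μ) B, cp_nonneg (G := G) (μ := μ) Bᶜ] with x h1 h2
      exact mul_nonneg h1 h2
  have hsm : StronglyMeasurable[G] (cp G μ B) := stronglyMeasurable_condExp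
  set A := {x | 1/2 < cp G μ B x} with hAdef
  have hA : MeasurableSet[G] A := hsm.measurable measurableSet_Ioi
  have hAB : cp G μ B =ᵐ[μ] A.indicator (fun _ => (1:ℝ)) := by
    filter_upwards [hsum, hz] with x h1 h2
    have h1' : cp G μ B x + cp G μ Bᶜ x = 1 := h1
    have h2' : cp G μ B x * cp G μ Bᶜ x = 0 := h2
    rcases mul_eq_zero.1 h2' with h3 | h3
    · have : x ∉ A := by simp [hAdef, h3]
      simp [this, h3]
    · have h4 : cp G μ B x = 1 := by linarith
      have : x ∈ A := by simp [hAdef, h4]; norm_num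
      simp [this, h4]
  refine ⟨A, hA, ?_⟩
  have hAm : MeasurableSet A := hG A hA
  -- the conditional integral determines the set
  have key : ∀ t, MeasurableSet[G] t → μ.real (B ∩ t) = μ.real (A ∩ t) := by
    intro t ht
    have e1 := setIntegral_condExp hG (int_ind (μ := μ) hB) ht
    have e2 : ∫ x in t, cp G μ B x ∂μ = ∫ x in t, A.indicator (fun _ => (1:ℝ)) x ∂μ :=
      setIntegral_congr_ae (hG t ht) (hAB.mono fun x hx _ => hx)
    have e3 : ∫ x in t, B.indicator (fun _ => (1:ℝ)) x ∂μ =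
        ∫ x in t, A.indicator (fun _ => (1:ℝ)) x ∂μ := e1.symm.trans e2
    rw [setIntegral_indicator hB, setIntegral_indicator hAm] at e3
    simp at e3
    rw [Set.inter_comm B, Set.inter_comm A]; exact e3
  have k1 := key A hA
  have k2 := key Aᶜ (@MeasurableSet.compl _ _ G hA)
  rw [Set.inter_compl_self, measureReal_empty] at k2
  rw [Set.inter_self] at k1
  rw [← measure_symmDiff_eq_zero_iff]
  have k3 : μ (B \ A) = 0 := by
    rw [Set.sdiff_eq]; exact (measureReal_eq_zero_iff).1 k2
  have k4 : μ (A \ B) = 0 := by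
    have := measureReal_sdiff_add_inter (μ := μ) (s := A) hB
    rw [Set.inter_comm, k1] at this
    have : μ.real (A \ B) = 0 := by linarith
    exact (measureReal_eq_zero_iff).1 this
  rw [Set.symmDiff_def]
  exact measure_union_null k3 k4

/-- level sets belong to the completion of a nontrivial factor -/
theorem full_of_nontrivial (C : ChaconMap μ (fun j => j)) (hG : G ≤ m)
    (h1 : ∀ A, MeasurableSet[G] A → MeasurableSet[G] (C.T ⁻¹' A))
    (h2 : ∀ A, MeasurableSet[G] A → MeasurableSet[G] (C.T.symm ⁻¹' A)) {A : Set X}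
    (hA : MeasurableSet[G] A) (hne : ¬ (μ A = 0 ∨ μ A = 1)) {j : ℕ} (hj : 1 ≤ j) {i : ℤ}
    (hi : 0 ≤ i) (hiH : i < HH j) : ∃ B, MeasurableSet[G] B ∧ Lv C j i =ᵐ[μ] B := by
  have hd := desc_Bset C (fun k => decide (k = i)) hj
  have he : Bset C j (fun k => decide (k = i)) = Lv C j i := by
    refine Set.ext fun x => ?_
    rw [mem_Bset]
    constructor
    · rintro ⟨k, _, _, hk, hx⟩
      rw [decide_eq_true_eq] at hk
      rwa [hk] at hx
    · intro hx
      exact ⟨i, hi, hiH, by simp, hx⟩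
  rw [he] at hd
  exact nuf_zero hG (measurableSet_Lv C j i)
    ((nuf_form C hG h1 h2).main_est (hG A hA) hne (nuf_self hG hA) hd)

end factor

theorem chacon_main {X : Type*} (F : MeasurableSpace X) [m : MeasurableSpace X] (μ : Measure X)
    [IsProbabilityMeasure μ] (C : ChaconMap μ (fun j => j)) (hF : F ≤ m)
    (h1 : ∀ A : Set X, MeasurableSet[F] A →
        ∃ B : Set X, MeasurableSet[F] B ∧ μ ((⇑C.T ⁻¹' A) ∆ B) = 0)
    (h2 : ∀ B : Set X, MeasurableSet[F] B →
        ∃ A : Set X, MeasurableSet[F] A ∧ μ ((⇑C.T ⁻¹' A) ∆ B) = 0) :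
    ((∀ A : Set X, MeasurableSet[F] A → μ A = 0 ∨ μ A = 1) ∨
        (∀ A : Set X, MeasurableSet[m] A →
          ∃ B : Set X, MeasurableSet[F] B ∧ μ (A ∆ B) = 0)) := by
  by_cases htriv : ∀ A : Set X, MeasurableSet[F] A → μ A = 0 ∨ μ A = 1
  · exact Or.inl htriv
  right
  push Not at htriv
  obtain ⟨A, hA, hA0, hA1⟩ := htriv
  have hS : MeasurePreserving C.T.symm μ μ := MeasurePreserving.symm C.T C.measurePreserving
  have hG : compl_alg F μ ≤ m := fun B hB => hB.1
  have g1 : ∀ A, MeasurableSet[compl_alg F μ] A → MeasurableSet[compl_alg F μ] (C.T ⁻¹' A) := by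
    rintro A ⟨hA, B, hB, hAB⟩
    obtain ⟨B', hB', hBB'⟩ := h1 B hB
    exact ⟨C.T.measurable hA, B', hB',
      (C.measurePreserving.quasiMeasurePreserving.preimage_ae_eq hAB).trans
        (measure_symmDiff_eq_zero_iff.1 hBB')⟩
  have g2 : ∀ A, MeasurableSet[compl_alg F μ] A →
      MeasurableSet[compl_alg F μ] (C.T.symm ⁻¹' A) := by
    rintro A ⟨hA, B, hB, hAB⟩
    obtain ⟨B', hB', hBB'⟩ := h2 B hB
    refine ⟨C.T.symm.measurable hA, B', hB', ?_⟩
    have e1 : A =ᵐ[μ] (⇑C.T ⁻¹' B' : Set X) := hAB.trans (measure_symmDiff_eq_zero_iff.1 hBB').symm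
    have e2 := hS.quasiMeasurePreserving.preimage_ae_eq e1
    have e3 : C.T.symm ⁻¹' (⇑C.T ⁻¹' B') = B' := by
      rw [← Set.preimage_comp]; simp
    rwa [e3] at e2
  have hA' : MeasurableSet[compl_alg F μ] A := ⟨hF A hA, A, hA, ae_eq_refl _⟩
  have hlev : MeasurableSpace.generateFrom
      {S : Set X | ∃ j, 1 ≤ j ∧ ∃ i ≤ C.h j, S = (⇑C.T)^[i] '' C.E j} ≤ compl_alg F μ := by
    refine MeasurableSpace.generateFrom_le ?_
    rintro S ⟨j, hj, i, hi, rfl⟩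
    have hH := HH_eq C j hj
    obtain ⟨B, hB, hBS⟩ := full_of_nontrivial C hG g1 g2 hA' (by tauto) hj
      (show (0:ℤ) ≤ i by omega) (by omega)
    obtain ⟨_, B', hB', hBB'⟩ := hB
    have hm := measurableSet_Lv C j (i:ℤ)
    exact ⟨hm, B', hB', hBS.trans hBB'⟩
  intro D hD
  obtain ⟨D', hD', hDD'⟩ := C.generates D hD
  obtain ⟨_, B, hB, hDB⟩ := hlev D' hD'
  exact ⟨B, hB, measure_symmDiff_eq_zero_iff.2
    ((measure_symmDiff_eq_zero_iff.1 hDD').trans hDB)⟩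

/-- the linear Chacon map has no nontrivial factors: every sub-σ-algebra
`F` with `T⁻¹ F = F` (mod `μ`-null sets) is either trivial mod `μ` or full mod `μ`.
(The map `⇑C.T` is abstracted as `Tmap` so that the quantification over the
sub-σ-algebra `F` does not interfere with instance resolution.) -/
theorem linearChacon_no_factors
    {X : Type*} [m : MeasurableSpace X] (μ : Measure X) [IsProbabilityMeasure μ]
    (C : ChaconMap μ (fun j => j)) (Tmap : X → X) (hTmap : Tmap = ⇑C.T) :
    ∀ F : MeasurableSpace X, F ≤ m →
      (∀ A : Set X, MeasurableSet[F] A →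
        ∃ B : Set X, MeasurableSet[F] B ∧ μ ((Tmap ⁻¹' A) ∆ B) = 0) →
      (∀ B : Set X, MeasurableSet[F] B →
        ∃ A : Set X, MeasurableSet[F] A ∧ μ ((Tmap ⁻¹' A) ∆ B) = 0) →
      ((∀ A : Set X, MeasurableSet[F] A → μ A = 0 ∨ μ A = 1) ∨
        (∀ A : Set X, MeasurableSet[m] A →
          ∃ B : Set X, MeasurableSet[F] B ∧ μ (A ∆ B) = 0)) := by
  subst hTmap
  intro F hF h1 h2
  exact chacon_main (m := m) F μ C hF h1 h2
end
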